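/- arXiv:1206.3214 — 3 statements merged into one kernel-verified Lean document; each statement's English description precedes it below -/
import Mathlib

section
/- Let (X,T) be a saturated topological dynamical system on a compact metric space, B a real Banach space with dual B*, r ≥ 1, Φ : X^r → B* continuous (B* carrying the weak* topology), W ⊂ B, and α ∈ B*. If M_Φ(α,W) ≠ ∅, then h_top(E_Φ(α,W)) = sup_{μ ∈ M_Φ(α,W)} h_μ. -/
open MeasureTheory Filter Topology
open scoped ENNReal NNReal

section Defs

variable {X : Type*} [MetricSpace X]

/-- The Bowen ball `B_n(x, ε)` for the dynamics `T`. -/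
def bowenBall (T : X → X) (n : ℕ) (ε : ℝ) (x : X) : Set X :=
  {y | ∀ j < n, dist (T^[j] x) (T^[j] y) < ε}

/-- `H^s_n(Z, ε)`: infimum of `∑ exp(-s n_i)` over countable covers of `Z` by Bowen balls
`B_{n_i}(x_i, ε)` with `n_i ≥ n`. -/
noncomputable def bowenHn (T : X → X) (Z : Set X) (s ε : ℝ) (n : ℕ) : ℝ≥0∞ :=
  ⨅ (c : ℕ → X × ℕ) (_ : Z ⊆ ⋃ i, bowenBall T (c i).2 ε (c i).1) (_ : ∀ i, n ≤ (c i).2),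
    ∑' i, ENNReal.ofReal (Real.exp (-(s * ((c i).2 : ℝ))))

/-- `H^s(Z, ε) = lim_n H^s_n(Z, ε)` (the quantities are nondecreasing in `n`). -/
noncomputable def bowenH (T : X → X) (Z : Set X) (s ε : ℝ) : ℝ≥0∞ :=
  ⨆ n : ℕ, bowenHn T Z s ε n

/-- `h_top(Z, ε)`: the critical value of `s ↦ H^s(Z, ε)`. -/
noncomputable def bowenEnt (T : X → X) (Z : Set X) (ε : ℝ) : ℝ≥0∞ :=
  ⨅ (s : ℝ≥0) (_ : bowenH T Z s ε = 0), (s : ℝ≥0∞)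

/-- Bowen's topological entropy of an arbitrary subset `Z ⊆ X`:
`h_top(Z) = lim_{ε → 0} h_top(Z, ε)`. -/
noncomputable def htop (T : X → X) (Z : Set X) : ℝ≥0∞ :=
  ⨆ (ε : ℝ) (_ : 0 < ε), bowenEnt T Z ε

variable [MeasurableSpace X]

/-- Shannon entropy of the finite measurable partition of `X` induced by `P : X → ι`. -/
noncomputable def partEntropy {ι : Type} [Fintype ι] (μ : Measure X) (P : X → ι) : ℝ :=
  ∑ i : ι, Real.negMulLog ((μ (P ⁻¹' {i})).toReal)

/-- The measure-theoretic (Kolmogorov–Sinai) entropy `h_μ(T)`: supremum over finite measurable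
partitions `P` of `lim_n (1/n) H_μ(P ∨ T⁻¹P ∨ ⋯ ∨ T^{-(n-1)}P)`, the limit being the
infimum by subadditivity. -/
noncomputable def hKS (T : X → X) (μ : Measure X) : ℝ≥0∞ :=
  ⨆ (k : ℕ) (P : X → Fin k) (_ : Measurable P),
    ENNReal.ofReal (⨅ n : ℕ,
      partEntropy μ (fun x => fun j : Fin (n + 1) => P (T^[(j : ℕ)] x)) / (n + 1))

/-- The V-statistics `V_Φ(n, x) = n^{-r} ∑_{1 ≤ i_1, …, i_r ≤ n} Φ(T^{i_1}x, …, T^{i_r}x)`. -/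
noncomputable def Vstat {r : ℕ} (T : X → X) (Φ : (Fin r → X) → ℝ) (n : ℕ) (x : X) : ℝ :=
  (∑ i : Fin r → Fin n, Φ (fun j => T^[(i j : ℕ) + 1] x)) / (n : ℝ) ^ r

/-- The level set `E_Φ(α) = {x : lim_n V_Φ(n,x) = α}`. -/
def Eset {r : ℕ} (T : X → X) (Φ : (Fin r → X) → ℝ) (α : ℝ) : Set X :=
  {x | Tendsto (fun n => Vstat T Φ n x) atTop (𝓝 α)}

/-- The fiber `M_Φ(α)`: the `T`-invariant Borel probability measures `μ` with
`∫_{X^r} Φ dμ^{⊗r} = α`. -/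
def Mset {r : ℕ} (T : X → X) (Φ : (Fin r → X) → ℝ) (α : ℝ) : Set (Measure X) :=
  {μ | IsProbabilityMeasure μ ∧ MeasurePreserving T μ μ ∧
    ∫ y, Φ y ∂(Measure.pi fun _ : Fin r => μ) = α}

/-- `x` is a generic point of `μ`: the empirical measures `(1/n) ∑_{j<n} δ_{T^j x}`
converge to `μ` in the weak star topology. -/
def IsGenericPt {X : Type*} [MetricSpace X] [MeasurableSpace X] (T : X → X) (μ : Measure X)
    (x : X) : Prop :=
  ∀ f : C(X, ℝ),
    Tendsto (fun n : ℕ => (∑ j ∈ Finset.range n, f (T^[j] x)) / n) atTop (𝓝 (∫ y, f y ∂μ))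

/-- A system is saturated if `h_top(G_μ) = h_μ` for every `T`-invariant Borel probability
measure `μ`, where `G_μ` is the set of `μ`-generic points. -/
def Saturated {X : Type*} [MetricSpace X] [MeasurableSpace X] (T : X → X) : Prop :=
  ∀ μ : Measure X, IsProbabilityMeasure μ → MeasurePreserving T μ μ →
    htop T {x | IsGenericPt T μ x} = hKS T μ

variable {B : Type*} [NormedAddCommGroup B] [NormedSpace ℝ B]

/-- The `B*`-valued V-statistics `V_Φ(n, x)` for a weak-star continuous kernel
`Φ : X^r → B*`. -/
noncomputable def VstatD {X : Type*} [MetricSpace X] {r : ℕ} (T : X → X)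
    (Φ : (Fin r → X) → WeakDual ℝ B) (n : ℕ) (x : X) : WeakDual ℝ B :=
  ((n : ℝ) ^ r)⁻¹ • ∑ i : Fin r → Fin n, Φ (fun j => T^[(i j : ℕ) + 1] x)

/-- `E_Φ(α, W) = {x : limsup_n ⟨V_Φ(n,x), w⟩ ≤ ⟨α, w⟩ for all w ∈ W}`. -/
def EsetD {X : Type*} [MetricSpace X] {r : ℕ} (T : X → X) (Φ : (Fin r → X) → WeakDual ℝ B)
    (α : WeakDual ℝ B) (W : Set B) : Set X :=
  {x | ∀ w ∈ W, limsup (fun n => VstatD T Φ n x w) atTop ≤ α w}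

/-- `M_Φ(α, W)`: the `T`-invariant Borel probability measures `μ` with
`∫_{X^r} ⟨Φ, w⟩ dμ^{⊗r} ≤ ⟨α, w⟩` for all `w ∈ W`. -/
def MsetD {X : Type*} [MetricSpace X] [MeasurableSpace X] {r : ℕ} (T : X → X)
    (Φ : (Fin r → X) → WeakDual ℝ B) (α : WeakDual ℝ B) (W : Set B) : Set (Measure X) :=
  {μ | IsProbabilityMeasure μ ∧ MeasurePreserving T μ μ ∧
    ∀ w ∈ W, ∫ y, Φ y w ∂(Measure.pi fun _ : Fin r => μ) ≤ α w}

end Defs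

section Empirical

variable {X : Type*} [MetricSpace X] [CompactSpace X] [MeasurableSpace X] [BorelSpace X]

/-- uniform measure on `Fin (n+1)` -/
noncomputable def unifFin (n : ℕ) : Measure (Fin (n + 1)) :=
  ((n + 1 : ℕ) : ℝ≥0∞)⁻¹ • Measure.count

instance (n : ℕ) : IsProbabilityMeasure (unifFin n) := by
  constructor
  simp only [unifFin, Measure.smul_apply, Measure.count_apply_finite _ Set.finite_univ, smul_eq_mul]
  simp
  exact ENNReal.inv_mul_cancel (by simp) (by finiteness)

lemma unifFin_real_singleton (n : ℕ) (i : Fin (n + 1)) :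
    (unifFin n).real {i} = ((n + 1 : ℕ) : ℝ)⁻¹ := by
  simp only [unifFin, Measure.real, Measure.smul_apply, Measure.count_singleton, smul_eq_mul, mul_one,
    ENNReal.toReal_inv, ENNReal.toReal_natCast]

/-- empirical measure of `x, Tx, …, T^n x` -/
noncomputable def empM (T : X → X) (n : ℕ) (x : X) : ProbabilityMeasure X :=
  ⟨(unifFin n).map (fun j : Fin (n + 1) => T^[(j : ℕ)] x),
    Measure.isProbabilityMeasure_map (measurable_of_finite _).aemeasurable⟩

lemma integral_empM (T : X → X) (n : ℕ) (x : X) (f : X → ℝ) (hf : Measurable f) :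
    ∫ y, f y ∂(empM T n x : Measure X) =
      (∑ j ∈ Finset.range (n + 1), f (T^[j] x)) / ((n + 1 : ℕ) : ℝ) := by
  have : (empM T n x : Measure X) = (unifFin n).map (fun j : Fin (n + 1) => T^[(j : ℕ)] x) := rfl
  rw [this, integral_map (measurable_of_finite _).aemeasurable hf.aestronglyMeasurable,
    integral_fintype (Integrable.of_finite)]
  simp_rw [unifFin_real_singleton, smul_eq_mul]
  rw [← Finset.mul_sum, Fin.sum_univ_eq_sum_range (fun j => f (T^[j] x))]
  rw [div_eq_inv_mul]

lemma integral_pi_empM {r : ℕ} (T : X → X) (n : ℕ) (x : X) (f : (Fin r → X) → ℝ)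
    (hf : Continuous f) :
    ∫ y, f y ∂(Measure.pi fun _ : Fin r => (empM T n x : Measure X)) =
      (((n + 1 : ℕ) : ℝ) ^ r)⁻¹ *
        ∑ i : Fin r → Fin (n + 1), f (fun j => T^[(i j : ℕ)] x) := by
  have h : (empM T n x : Measure X) = (unifFin n).map (fun j : Fin (n + 1) => T^[(j : ℕ)] x) := rfl
  have hp : IsProbabilityMeasure ((unifFin n).map (fun j : Fin (n + 1) => T^[(j : ℕ)] x)) :=
    Measure.isProbabilityMeasure_map (measurable_of_finite _).aemeasurable
  simp_rw [h]
  rw [← Measure.pi_map_pi (fun _ => (measurable_of_finite _).aemeasurable),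
    integral_map (measurable_of_finite _).aemeasurable hf.aestronglyMeasurable,
    integral_fintype (Integrable.of_finite)]
  have : ∀ i : Fin r → Fin (n + 1), (Measure.pi fun _ : Fin r => unifFin n).real {i} =
      (((n + 1 : ℕ) : ℝ) ^ r)⁻¹ := by
    intro i
    have := fun j => unifFin_real_singleton n (i j)
    simp only [Measure.real] at this
    rw [Measure.real, Measure.pi_singleton, ENNReal.toReal_prod]
    simp_rw [this]
    simp
  simp_rw [this, smul_eq_mul]
  rw [← Finset.mul_sum]

lemma empM_map (T : X → X) (hT : Continuous T) (n : ℕ) (x : X) :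
    (empM T n x).map hT.measurable.aemeasurable = empM T n (T x) := by
  apply Subtype.ext
  change Measure.map T ((unifFin n).map (fun j : Fin (n + 1) => T^[(j : ℕ)] x)) =
    (unifFin n).map (fun j : Fin (n + 1) => T^[(j : ℕ)] (T x))
  rw [Measure.map_map hT.measurable (measurable_of_finite _)]
  congr 1
  funext j
  simp only [Function.comp]
  exact (Function.iterate_succ_apply' T j x).symm.trans (Function.iterate_succ_apply T j x)

/-- If empirical measures converge along `l ≤ atTop`, then the limit is invariant. -/
lemma empM_tendsto_invariant (T : X → X) (hT : Continuous T) (x : X) (l : Filter ℕ) [l.NeBot]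
    (hl : l ≤ atTop) (μ : ProbabilityMeasure X) (h : Tendsto (fun n => empM T n x) l (𝓝 μ)) :
    μ.map hT.measurable.aemeasurable = μ := by
  have h1 : Tendsto (fun n => empM T n (T x)) l (𝓝 (μ.map hT.measurable.aemeasurable)) := by
    have := ((ProbabilityMeasure.continuous_map hT).tendsto μ).comp h
    refine this.congr fun n => ?_
    exact empM_map T hT n x
  refine tendsto_nhds_unique h1 ?_
  rw [ProbabilityMeasure.tendsto_iff_forall_integral_tendsto] at h ⊢
  intro f
  have h0 : Tendsto (fun n : ℕ => (f (T^[n + 1] x) - f x) / ((n + 1 : ℕ) : ℝ)) l (𝓝 0) := by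
    have h2 : Tendsto (fun n : ℕ => 2 * ‖f‖ / ((n + 1 : ℕ) : ℝ)) l (𝓝 0) := by
      refine Tendsto.mono_left ?_ hl
      exact (tendsto_const_div_atTop_nhds_zero_nat (2 * ‖f‖)).comp (tendsto_add_atTop_nat 1)
    refine squeeze_zero_norm (fun n => ?_) h2
    rw [norm_div, Real.norm_natCast]
    gcongr
    calc ‖f (T^[n + 1] x) - f x‖ ≤ ‖f (T^[n + 1] x)‖ + ‖f x‖ := norm_sub_le _ _
      _ ≤ ‖f‖ + ‖f‖ := add_le_add (f.norm_coe_le_norm _) (f.norm_coe_le_norm _)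
      _ = _ := by ring
  have := (h f).add h0
  rw [add_zero] at this
  refine this.congr fun n => ?_
  rw [integral_empM _ _ _ _ f.continuous.measurable, integral_empM _ _ _ _ f.continuous.measurable,
    ← add_div]
  congr 1
  simp_rw [← Function.iterate_succ_apply]
  rw [Finset.sum_range_succ', Finset.sum_range_succ (fun k => f (T^[k.succ] x))]
  simp

variable {B : Type*} [NormedAddCommGroup B] [NormedSpace ℝ B]

lemma VstatD_succ {r : ℕ} (T : X → X) (Φ : (Fin r → X) → WeakDual ℝ B) (hΦ : Continuous Φ)
    (n : ℕ) (x : X) (w : B) :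
    VstatD T Φ (n + 1) x w =
      ∫ y, Φ y w ∂(Measure.pi fun _ : Fin r => (empM T n (T x) : Measure X)) := by
  have hc : Continuous fun y => Φ y w := (WeakDual.eval_continuous w).comp hΦ
  rw [integral_pi_empM T n (T x) _ hc]
  simp only [VstatD]
  rw [show ∀ (c : ℝ) (φ : WeakDual ℝ B), (c • φ) w = c * φ w from fun c φ => rfl]
  congr 1
  let ev : WeakDual ℝ B →+ ℝ := ⟨⟨fun φ => φ w, rfl⟩, fun _ _ => rfl⟩
  exact map_sum ev _ _

lemma continuous_pi_integral {r : ℕ} (f : (Fin r → X) → ℝ) (hf : Continuous f) :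
    Continuous fun μ : ProbabilityMeasure X =>
      ∫ y, f y ∂(Measure.pi fun _ : Fin r => (μ : Measure X)) := by
  have h1 : Continuous fun μ : ProbabilityMeasure X =>
      ProbabilityMeasure.pi (fun _ : Fin r => μ) :=
    ProbabilityMeasure.continuous_pi.comp (continuous_pi fun _ => continuous_id)
  have h2 := ProbabilityMeasure.continuous_integral_boundedContinuousFunction
    (X := Fin r → X) (BoundedContinuousFunction.mkOfCompact ⟨f, hf⟩)
  exact h2.comp h1

lemma VstatD_tendsto {r : ℕ} (T : X → X) (hT : Continuous T) (Φ : (Fin r → X) → WeakDual ℝ B)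
    (hΦ : Continuous Φ) (x : X) (w : B) (l : Filter ℕ) (μ : ProbabilityMeasure X)
    (hμ : μ.map hT.measurable.aemeasurable = μ)
    (h : Tendsto (fun n => empM T n x) l (𝓝 μ)) :
    Tendsto (fun n => VstatD T Φ (n + 1) x w) l
      (𝓝 (∫ y, Φ y w ∂(Measure.pi fun _ : Fin r => (μ : Measure X)))) := by
  have h1 : Tendsto (fun n => empM T n (T x)) l (𝓝 μ) := by
    have := ((ProbabilityMeasure.continuous_map hT).tendsto μ).comp h
    rw [hμ] at this
    refine this.congr fun n => ?_
    exact empM_map T hT n x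
  have hc : Continuous fun y => Φ y w := (WeakDual.eval_continuous w).comp hΦ
  have := ((continuous_pi_integral _ hc).tendsto μ).comp h1
  refine this.congr fun n => ?_
  rw [VstatD_succ T Φ hΦ]
  rfl

end Empirical

section Counting

/-- Weighted count of words along disjoint blocks. -/
lemma block_sum_le {Y A : Type*} [Fintype A] [DecidableEq A] (m L i : ℕ) (hi : i < m)
    (q : (Fin m → A) → ℝ) (hq : ∀ w, 0 ≤ q w) (hq1 : ∑ w, q w = 1)
    (a : Y → ℕ → A) (F : Finset Y)
    (hF : ∀ x ∈ F, ∀ y ∈ F, (∀ p < m * (L + 1), a x p = a y p) → x = y) :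
    ∑ x ∈ F, ∏ l : Fin L, q (fun t : Fin m => a x (i + m * l + t)) ≤ (Fintype.card A : ℝ) ^ m := by
  classical
  let g : Y → (Fin L → Fin m → A) × (Fin m → A) := fun x =>
    (fun l t => a x (i + m * l + t), fun p => if (p : ℕ) < i then a x p else a x (p + m * L))
  have hinj : Set.InjOn g F := by
    intro x hx y hy hxy
    apply hF x hx y hy
    intro p hp
    have h1 : ∀ l : Fin L, ∀ t : Fin m, a x (i + m * l + t) = a y (i + m * l + t) := by
      intro l t
      exact congrFun (congrFun (congrArg Prod.fst hxy) l) t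
    have h2 : ∀ p : Fin m, (if (p : ℕ) < i then a x p else a x (p + m * L)) =
        (if (p : ℕ) < i then a y p else a y (p + m * L)) := by
      intro p
      exact congrFun (congrArg Prod.snd hxy) p
    by_cases h : p < i
    · have := h2 ⟨p, by omega⟩
      simpa [h] using this
    · by_cases h' : i + m * L ≤ p
      · have hp' : p < m * L + m := by rw [Nat.mul_succ] at hp; exact hp
        have := h2 ⟨p - m * L, by omega⟩
        have h3 : ¬ (p - m * L < i) := by omega
        have h4 : p - m * L + m * L = p := by omega
        simpa [h3, h4] using this
      · have hm : 0 < m := by omega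
        have hl : (p - i) / m < L := by
          rw [Nat.div_lt_iff_lt_mul hm, mul_comm]; omega
        have := h1 ⟨(p - i) / m, hl⟩ ⟨(p - i) % m, Nat.mod_lt _ hm⟩
        have h5 : i + m * ((p - i) / m) + (p - i) % m = p := by
          have := Nat.div_add_mod (p - i) m
          omega
        simpa [h5] using this
  calc ∑ x ∈ F, ∏ l : Fin L, q (fun t : Fin m => a x (i + m * l + t))
      = ∑ z ∈ F.image g, ∏ l : Fin L, q (z.1 l) := by
        rw [Finset.sum_image hinj]
    _ ≤ ∑ z : (Fin L → Fin m → A) × (Fin m → A), ∏ l : Fin L, q (z.1 l) := by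
        apply Finset.sum_le_sum_of_subset_of_nonneg (Finset.subset_univ _)
        intro z _ _
        exact Finset.prod_nonneg fun l _ => hq _
    _ = (Fintype.card A : ℝ) ^ m := by
        rw [Fintype.sum_prod_type]
        simp only [Finset.sum_const, Finset.card_univ, nsmul_eq_mul]
        rw [← Finset.mul_sum, ← Fintype.piFinset_univ, ← Finset.prod_univ_sum]
        simp [hq1]

lemma card_le_of_log {Y A : Type*} [Fintype A] [DecidableEq A] (m n : ℕ) (hm : 0 < m) (s : ℝ)
    (q : (Fin m → A) → ℝ) (hq : ∀ w, 0 < q w) (hq1 : ∑ w, q w = 1)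
    (a : Y → ℕ → A) (F : Finset Y)
    (hF : ∀ x ∈ F, ∀ y ∈ F, (∀ p < m * (n / m + 1), a x p = a y p) → x = y)
    (hs : ∀ x ∈ F, ∑ j ∈ Finset.range n, -Real.log (q (fun t : Fin m => a x (j + t)))
      ≤ n * (m * s)) :
    (F.card : ℝ) ≤ (m * (Fintype.card A : ℝ) ^ m) * Real.exp (s * n) := by
  set L := n / m with hL
  have hqle : ∀ w, q w ≤ 1 := fun w => by
    rw [← hq1]; exact Finset.single_le_sum (fun v _ => (hq v).le) (Finset.mem_univ w)
  have key : ∀ x ∈ F, 1 ≤ ∑ i ∈ Finset.range m, Real.exp (s * n) *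
      ∏ l : Fin L, q (fun t : Fin m => a x (i + m * l + t)) := by
    intro x hx
    set f : ℕ → ℝ := fun j => -Real.log (q (fun t : Fin m => a x (j + t))) with hf
    have hf0 : ∀ j, 0 ≤ f j := fun j => by
      have := Real.log_nonpos (hq (fun t : Fin m => a x (j + t))).le (hqle _)
      simp only [hf]; linarith
    have h1 : ∑ i ∈ Finset.range m, ∑ l : Fin L, f (i + m * l) ≤ ∑ i ∈ Finset.range m, n * s := by
      have e1 : ∑ i ∈ Finset.range m, ∑ l : Fin L, f (i + m * l) =
          ∑ j ∈ Finset.range (L * m), f j := by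
        rw [Finset.sum_comm, Fin.sum_univ_eq_sum_range (fun l => ∑ i ∈ Finset.range m, f (i + m * l))]
        clear_value L
        clear hL hF
        induction L with
        | zero => simp
        | succ k ih =>
          rw [Finset.sum_range_succ, ih, Nat.succ_mul, Finset.sum_range_add]
          congr 1
          apply Finset.sum_congr rfl
          intro i _
          congr 1; ring
      rw [e1]
      calc _ ≤ ∑ j ∈ Finset.range n, f j := by
            apply Finset.sum_le_sum_of_subset_of_nonneg
            · apply Finset.range_subset_range.2
              exact Nat.div_mul_le_self n m
            · intro j _ _; exact hf0 j
        _ ≤ n * (m * s) := hs x hx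
        _ = _ := by simp; ring
    obtain ⟨i, hi, hi2⟩ := Finset.exists_le_of_sum_le (by simpa using hm.ne') h1
    have h2 : 1 ≤ Real.exp (s * n) * ∏ l : Fin L, q (fun t : Fin m => a x (i + m * l + t)) := by
      have : ∏ l : Fin L, q (fun t : Fin m => a x (i + m * l + t)) =
          Real.exp (-∑ l : Fin L, f (i + m * l)) := by
        rw [← Finset.sum_neg_distrib, Real.exp_sum]
        apply Finset.prod_congr rfl
        intro l _
        simp only [hf, neg_neg]
        rw [Real.exp_log (hq _)]
      rw [this, ← Real.exp_add]
      apply Real.one_le_exp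
      linarith
    refine h2.trans ?_
    apply Finset.single_le_sum (f := fun i => Real.exp (s * n) *
      ∏ l : Fin L, q (fun t : Fin m => a x (i + m * l + t))) _ hi
    intro j _
    exact mul_nonneg (Real.exp_pos _).le (Finset.prod_nonneg fun l _ => (hq _).le)
  calc (F.card : ℝ) = ∑ x ∈ F, 1 := by simp
    _ ≤ ∑ x ∈ F, ∑ i ∈ Finset.range m, Real.exp (s * n) *
      ∏ l : Fin L, q (fun t : Fin m => a x (i + m * l + t)) := Finset.sum_le_sum key
    _ = ∑ i ∈ Finset.range m, Real.exp (s * n) * ∑ x ∈ F,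
      ∏ l : Fin L, q (fun t : Fin m => a x (i + m * l + t)) := by
        rw [Finset.sum_comm]
        simp_rw [Finset.mul_sum]
    _ ≤ ∑ i ∈ Finset.range m, Real.exp (s * n) * (Fintype.card A : ℝ) ^ m := by
        apply Finset.sum_le_sum
        intro i hi
        gcongr
        exact block_sum_le m L i (Finset.mem_range.1 hi) q (fun w => (hq w).le) hq1 a F hF
    _ = _ := by simp; ring

end Counting

section LocalCover

variable {X : Type*} [MetricSpace X] [CompactSpace X] [MeasurableSpace X] [BorelSpace X]

/-- A finite partition into small pieces, locally constant off a null closed-type set. -/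
lemma exists_partition (μ : Measure X) [IsProbabilityMeasure μ] (ε : ℝ) (hε : 0 < ε) :
    ∃ (k : ℕ) (P : X → Fin k) (D : Set X), Measurable P ∧ μ D = 0 ∧ MeasurableSet D ∧
      (∀ x ∉ D, ∀ᶠ y in 𝓝 x, P y = P x) ∧ ∀ x y, P x = P y → dist x y < ε := by
  classical
  have A : ∀ x : X, ∃ ρ ∈ Set.Ioo 0 (ε / 2), μ (frontier (Metric.thickening ρ {x})) = 0 :=
    fun x => exists_null_frontier_thickening μ {x} (by positivity)
  choose ρ hρ hρ0 using A
  simp only [Metric.thickening_singleton] at hρ0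
  obtain ⟨t, -, ht⟩ := isCompact_univ.elim_nhds_subcover (fun x => Metric.ball x (ρ x))
    (fun x _ => Metric.ball_mem_nhds x (hρ x).1)
  let Q : X → (t → Bool) := fun x i => decide (x ∈ Metric.ball (i : X) (ρ i))
  let e := Fintype.equivFin (t → Bool)
  refine ⟨_, fun x => e (Q x), ⋃ i : t, frontier (Metric.ball (i : X) (ρ i)), ?_, ?_, ?_, ?_, ?_⟩
  · have hQ : Measurable Q := by
      apply measurable_pi_lambda
      intro i
      apply measurable_to_bool
      have : (fun x => Q x i) ⁻¹' {true} = Metric.ball (i : X) (ρ i) := by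
        ext x; simp [Q]
      rw [this]
      exact measurableSet_ball
    exact (measurable_of_finite e).comp hQ
  · exact measure_iUnion_null fun i => hρ0 i
  · exact MeasurableSet.iUnion fun i => isClosed_frontier.measurableSet
  · intro x hx
    simp only [Set.mem_iUnion, not_exists] at hx
    have : ∀ᶠ y in 𝓝 x, ∀ i, Q y i = Q x i := by
      rw [eventually_all]
      intro i
      by_cases hxi : x ∈ Metric.ball (i : X) (ρ i)
      · filter_upwards [Metric.isOpen_ball.mem_nhds hxi] with y hy
        simp only [Q, hy, hxi]
      · have hc : x ∉ closure (Metric.ball (i : X) (ρ i)) := by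
          intro hc
          apply hx i
          rw [Metric.isOpen_ball.frontier_eq]
          exact ⟨hc, hxi⟩
        filter_upwards [isClosed_closure.isOpen_compl.mem_nhds hc] with y hy
        have hy' : y ∉ Metric.ball (i : X) (ρ i) := fun h => hy (subset_closure h)
        simp only [Q, hy', hxi]
    filter_upwards [this] with y hy
    congr 1
    funext i
    exact hy i
  · intro x y hxy
    have hQ : Q x = Q y := e.injective hxy
    have hx : x ∈ ⋃ z ∈ t, Metric.ball z (ρ z) := ht (Set.mem_univ x)
    simp only [Set.mem_iUnion] at hx
    obtain ⟨z, hz, hxz⟩ := hx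
    have := congrFun hQ ⟨z, hz⟩
    simp only [Q, hxz, decide_true] at this
    have hyz : y ∈ Metric.ball z (ρ z) := by simpa using this.symm
    rw [Metric.mem_ball] at hxz hyz
    have := dist_triangle_right x y z
    have := (hρ z).2
    linarith

lemma local_cover (T : X → X) (hT : Continuous T) (μ : ProbabilityMeasure X)
    (hμ : MeasurePreserving T (μ : Measure X) μ) (s ε : ℝ) (hε : 0 < ε)
    (hs : hKS T (μ : Measure X) < ENNReal.ofReal s) :
    ∃ U ∈ 𝓝 μ, ∃ C : ℝ, ∀ n : ℕ, ∃ F : Finset X,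
      (F.card : ℝ) ≤ C * Real.exp (s * ((n + 1 : ℕ) : ℝ)) ∧
      ∀ x, empM T n x ∈ U → ∃ y ∈ F, x ∈ bowenBall T (n + 1) ε y := by
  classical
  obtain ⟨k, P, D, hP, hD0, hDm, hDc, hPd⟩ := exists_partition (μ : Measure X) ε hε
  have h1 : ENNReal.ofReal (⨅ n : ℕ,
      partEntropy (μ : Measure X) (fun x => fun j : Fin (n + 1) => P (T^[(j : ℕ)] x)) / (n + 1))
        < ENNReal.ofReal s := by
    refine lt_of_le_of_lt ?_ hs
    unfold hKS
    exact le_iSup_of_le k (le_iSup_of_le P (le_iSup_of_le hP le_rfl))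
  have h2 := lt_of_not_ge fun h => absurd h1 (not_lt.2 (ENNReal.ofReal_le_ofReal h))
  obtain ⟨m', hm'⟩ := exists_lt_of_ciInf_lt h2
  set m := m' + 1 with hm
  have hmpos : (0 : ℝ) < m := by positivity
  have hm'' : partEntropy (μ : Measure X) (fun x => fun j : Fin m => P (T^[(j : ℕ)] x)) < m * s := by
    have e : ((m' : ℝ) + 1) = m := by simp [hm]
    rw [e, div_lt_iff₀ hmpos] at hm'
    linarith
  set Q : X → (Fin m → Fin k) := fun x => fun j : Fin m => P (T^[(j : ℕ)] x) with hQ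
  have hQm : Measurable Q := by
    apply measurable_pi_lambda
    intro j
    exact hP.comp (hT.iterate j).measurable
  set p : (Fin m → Fin k) → ℝ := fun w => ((μ : Measure X) (Q ⁻¹' {w})).toReal with hp
  have hp0 : ∀ w, 0 ≤ p w := fun w => ENNReal.toReal_nonneg
  have hint : ∀ (ν : ProbabilityMeasure X) (g : (Fin m → Fin k) → ℝ),
      ∫ x, g (Q x) ∂(ν : Measure X) = ∑ w, ((ν : Measure X) (Q ⁻¹' {w})).toReal * g w := by
    intro ν g
    have hpm : IsProbabilityMeasure ((ν : Measure X).map Q) :=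
      Measure.isProbabilityMeasure_map hQm.aemeasurable
    rw [← integral_map (φ := Q) (f := g) hQm.aemeasurable (measurable_of_finite g).aestronglyMeasurable,
      integral_fintype Integrable.of_finite]
    apply Finset.sum_congr rfl
    intro w _
    rw [Measure.real, Measure.map_apply hQm (measurableSet_singleton w), smul_eq_mul]
  have hp1 : ∑ w, p w = 1 := by
    have := hint μ (fun _ => 1)
    simpa using this.symm
  have hXne : Nonempty X := by
    by_contra h
    rw [not_nonempty_iff] at h
    have : (μ : Measure X) Set.univ = 1 := measure_univ
    rw [Set.univ_eq_empty_iff.2 h] at this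
    simp at this
  have hWne : Nonempty (Fin m → Fin k) := hXne.map Q
  set K : ℝ := ((Fintype.card (Fin m → Fin k) : ℕ) : ℝ) with hK
  have hKpos : 0 < K := by
    rw [hK]; exact_mod_cast Fintype.card_pos
  set H := partEntropy (μ : Measure X) Q with hH
  set c := (m * s - H) / 2 with hc
  have hcpos : 0 < c := by rw [hc]; linarith
  set lam := Real.exp (-c) with hlam
  have hlam0 : 0 < lam := Real.exp_pos _
  have hlam1 : lam < 1 := by rw [hlam, Real.exp_lt_one_iff]; linarith
  set q : (Fin m → Fin k) → ℝ := fun w => lam * p w + (1 - lam) / K with hq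
  have hq0 : ∀ w, 0 < q w := fun w => by
    have : 0 < (1 - lam) / K := div_pos (by linarith) hKpos
    have := mul_nonneg hlam0.le (hp0 w)
    simp only [hq]; linarith
  have hq1 : ∑ w, q w = 1 := by
    simp only [hq]
    rw [Finset.sum_add_distrib, ← Finset.mul_sum, hp1]
    simp only [Finset.sum_const, Finset.card_univ, nsmul_eq_mul]
    rw [← hK]
    field_simp
    ring
  have hcross : ∑ w, p w * -Real.log (q w) < m * s := by
    have : ∑ w, p w * -Real.log (q w) ≤ ∑ w, (Real.negMulLog (p w) + p w * c) := by
      apply Finset.sum_le_sum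
      intro w _
      rcases (hp0 w).eq_or_lt with h | h
      · simp [← h]
      · have : Real.log (lam * p w) ≤ Real.log (q w) := by
          apply Real.log_le_log (by positivity)
          have : 0 < (1 - lam) / K := div_pos (by linarith) hKpos
          simp only [hq]; linarith
        rw [Real.log_mul hlam0.ne' h.ne', hlam, Real.log_exp] at this
        rw [Real.negMulLog]
        nlinarith
    rw [Finset.sum_add_distrib, ← Finset.sum_mul, hp1] at this
    have e : ∑ w, Real.negMulLog (p w) = H := rfl
    rw [e] at this
    have : H + 1 * c < m * s := by rw [hc]; linarith
    linarith
  refine ⟨{ν | ∑ w, ((ν : Measure X) (Q ⁻¹' {w})).toReal * -Real.log (q w) < m * s}, ?_,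
    m * (Fintype.card (Fin k) : ℝ) ^ m, ?_⟩
  · have hfr : ∀ w, (μ : Measure X) (frontier (Q ⁻¹' {w})) = 0 := by
      intro w
      have hnull : (μ : Measure X) (⋃ j : Fin m, T^[(j : ℕ)] ⁻¹' D) = 0 := by
        apply measure_iUnion_null
        intro j
        rw [(hμ.iterate j).measure_preimage hDm.nullMeasurableSet]
        exact hD0
      refine measure_mono_null ?_ hnull
      intro x hx
      by_contra hxD
      simp only [Set.mem_iUnion, Set.mem_preimage, not_exists] at hxD
      have hev : ∀ᶠ y in 𝓝 x, Q y = Q x := by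
        have : ∀ᶠ y in 𝓝 x, ∀ j : Fin m, P (T^[(j : ℕ)] y) = P (T^[(j : ℕ)] x) := by
          rw [eventually_all]
          intro j
          exact ((hT.iterate j).tendsto x).eventually (hDc _ (hxD j))
        filter_upwards [this] with y hy
        funext j
        exact hy j
      by_cases hxw : Q x = w
      · apply hx.2
        rw [mem_interior_iff_mem_nhds]
        filter_upwards [hev] with y hy
        simp [hy, hxw]
      · have := mem_closure_iff_frequently.1 hx.1
        obtain ⟨y, hy1, hy2⟩ := (this.and_eventually hev).exists
        exact hxw (hy2 ▸ hy1)
    have hcont : Tendsto (fun ν : ProbabilityMeasure X =>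
        ∑ w, ((ν : Measure X) (Q ⁻¹' {w})).toReal * -Real.log (q w)) (𝓝 μ)
        (𝓝 (∑ w, p w * -Real.log (q w))) := by
      apply tendsto_finsetSum
      intro w _
      apply Tendsto.mul_const
      have := ProbabilityMeasure.tendsto_measure_of_null_frontier_of_tendsto'
        (tendsto_id (x := 𝓝 μ)) (hfr w)
      exact (ENNReal.tendsto_toReal (measure_ne_top _ _)).comp this
    exact hcont.eventually (gt_mem_nhds hcross)
  · intro n
    set N := m * ((n + 1) / m + 1) with hN
    have hnN : n + 1 ≤ N := by
      have := Nat.div_add_mod (n + 1) m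
      have h2 : (n + 1) % m < m := Nat.mod_lt _ (by omega)
      rw [hN, mul_add, mul_one]
      omega
    set Z : Set X := {x | ∑ w, ((empM T n x : Measure X) (Q ⁻¹' {w})).toReal * -Real.log (q w)
      < m * s} with hZ
    let nm : X → (Fin N → Fin k) := fun x j => P (T^[(j : ℕ)] x)
    obtain ⟨F', hF'Z, hbij⟩ := Set.exists_subset_bijOn Z nm
    have hfin : F'.Finite := Set.Finite.of_finite_image (Set.toFinite _) hbij.injOn
    refine ⟨hfin.toFinset, ?_, ?_⟩
    · apply card_le_of_log m (n + 1) (by omega) s q hq0 hq1 (fun x j => P (T^[j] x))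
      · intro x hx y hy hxy
        apply hbij.injOn (by simpa using hx) (by simpa using hy)
        funext j
        exact hxy j j.2
      · intro x hx
        have hxZ : x ∈ Z := hF'Z (by simpa using hx)
        simp only [hZ, Set.mem_ofPred_eq] at hxZ
        rw [← hint (empM T n x) (fun w => -Real.log (q w)),
          integral_empM T n x (fun z => -Real.log (q (Q z))) ((measurable_of_finite (fun w => -Real.log (q w))).comp hQm),
          div_lt_iff₀ (by positivity)] at hxZ
        rw [mul_comm (m * s)] at hxZ
        refine le_trans (le_of_eq ?_) hxZ.le
        apply Finset.sum_congr rfl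
        intro j _
        have e : Q (T^[j] x) = fun t : Fin m => P (T^[j + t] x) := by
          funext t
          simp only [hQ]
          rw [← Function.iterate_add_apply, add_comm]
        rw [e]
    · intro x hx
      have hxZ : x ∈ Z := hx
      obtain ⟨y, hy, hyx⟩ := hbij.surjOn ⟨x, hxZ, rfl⟩
      refine ⟨y, by simpa using hy, ?_⟩
      intro j hj
      apply hPd
      exact congrFun hyx ⟨j, by omega⟩

end LocalCover

section Global

variable {X : Type*} [MetricSpace X]

lemma bowenHn_le_of_cover (T : X → X) (Z : Set X) (s ε : ℝ) (N : ℕ) {ι : Type*} [Countable ι]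
    [Infinite ι] (c : ι → X × ℕ) (hc : ∀ i, N ≤ (c i).2)
    (hZ : Z ⊆ ⋃ i, bowenBall T (c i).2 ε (c i).1) :
    bowenHn T Z s ε N ≤ ∑' i, ENNReal.ofReal (Real.exp (-(s * ((c i).2 : ℝ)))) := by
  obtain ⟨hd⟩ := nonempty_denumerable ι
  let e : ℕ ≃ ι := (Denumerable.eqv ι).symm
  rw [← e.tsum_eq]
  unfold bowenHn
  refine iInf_le_of_le (fun n => c (e n)) (iInf_le_of_le ?_ (iInf_le_of_le (fun i => hc _) le_rfl))
  intro x hx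
  obtain ⟨i, hi⟩ := Set.mem_iUnion.1 (hZ hx)
  refine Set.mem_iUnion.2 ⟨e.symm i, ?_⟩
  simpa using hi

lemma bowenHn_mono_n (T : X → X) (Z : Set X) (s ε : ℝ) {n N : ℕ} (h : n ≤ N) :
    bowenHn T Z s ε n ≤ bowenHn T Z s ε N := by
  unfold bowenHn
  refine iInf_mono fun c => iInf_mono fun hc => ?_
  exact le_iInf fun hN => iInf_le_of_le (fun i => h.trans (hN i)) le_rfl

lemma htop_mono (T : X → X) {Z Z' : Set X} (h : Z ⊆ Z') : htop T Z ≤ htop T Z' := by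
  have h1 : ∀ s ε n, bowenHn T Z s ε n ≤ bowenHn T Z' s ε n := by
    intro s ε n
    unfold bowenHn
    refine iInf_mono fun c => ?_
    exact le_iInf fun hc => iInf_le_of_le (h.trans hc) le_rfl
  have h2 : ∀ s ε, bowenH T Z s ε ≤ bowenH T Z' s ε := fun s ε => iSup_mono fun n => h1 s ε n
  refine iSup_mono fun ε => iSup_mono fun _ => ?_
  unfold bowenEnt
  refine iInf_mono fun s => ?_
  exact le_iInf fun hs => iInf_le_of_le (le_antisymm ((h2 _ _).trans hs.le) bot_le) le_rfl

lemma bowenH_eq_zero (T : X → X) (Z : Set X) (x0 : X) (s s' ε C : ℝ) (hs' : 0 ≤ s') (hss : s' < s)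
    (F : ℕ → Finset X)
    (hF : ∀ n, ((F n).card : ℝ) ≤ C * Real.exp (s' * ((n + 1 : ℕ) : ℝ)))
    (hZ : ∀ x ∈ Z, ∃ᶠ n in atTop, ∃ y ∈ F n, x ∈ bowenBall T (n + 1) ε y) :
    bowenH T Z s ε = 0 := by
  let g : ℕ → ℝ := fun n => (C + 1) * (Real.exp (s' - s) * Real.exp (n * (s' - s)))
  have hg : Summable g := by
    apply Summable.mul_left
    apply Summable.mul_left
    exact Real.summable_exp_nat_mul_iff.2 (by linarith)
  have hlim := ENNReal.tendsto_sum_nat_add (fun n => ENNReal.ofReal (g n)) hg.tsum_ofReal_ne_top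
  have hN : ∀ N, bowenHn T Z s ε N ≤ ∑' k, ENNReal.ofReal (g (k + N)) := by
    intro N
    let c : (Σ n : ℕ, Option (F (n + N))) → X × ℕ := fun z =>
      ((z.2.map Subtype.val).getD x0, z.1 + N + 1)
    refine (bowenHn_le_of_cover T Z s ε N c (fun i => ?_) ?_).trans ?_
    · simp only [c]; omega
    · intro x hx
      obtain ⟨n, hn, y, hy, hxy⟩ := (frequently_atTop.1 (hZ x hx)) N
      obtain ⟨k, rfl⟩ : ∃ k, n = k + N := ⟨n - N, by omega⟩
      exact Set.mem_iUnion.2 ⟨⟨k, some ⟨y, hy⟩⟩, hxy⟩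
    · rw [ENNReal.tsum_sigma']
      refine ENNReal.tsum_le_tsum fun n => ?_
      simp only [c, tsum_fintype, Finset.sum_const, Finset.card_univ, Fintype.card_option,
        Fintype.card_coe, nsmul_eq_mul]
      rw [← ENNReal.ofReal_natCast, ← ENNReal.ofReal_mul (by positivity)]
      apply ENNReal.ofReal_le_ofReal
      have h1 := hF (n + N)
      have h2 : (1 : ℝ) ≤ Real.exp (s' * ((n + N + 1 : ℕ) : ℝ)) :=
        Real.one_le_exp (by positivity)
      have h3 : (((F (n + N)).card + 1 : ℕ) : ℝ) ≤
          (C + 1) * Real.exp (s' * ((n + N + 1 : ℕ) : ℝ)) := by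
        push_cast at h1 h2 ⊢
        linarith
      refine (mul_le_mul_of_nonneg_right h3 (Real.exp_pos _).le).trans (le_of_eq ?_)
      simp only [g]
      rw [mul_assoc, ← Real.exp_add, ← Real.exp_add]
      congr 2
      push_cast
      ring
  unfold bowenH
  refine le_antisymm (iSup_le fun n => ?_) bot_le
  refine ge_of_tendsto hlim ?_
  filter_upwards [eventually_ge_atTop n] with N hn
  exact (bowenHn_mono_n T Z s ε hn).trans (hN N)

variable [CompactSpace X] [MeasurableSpace X] [BorelSpace X]
variable {B : Type*} [NormedAddCommGroup B] [NormedSpace ℝ B]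

lemma measurePreserving_iff_map (T : X → X) (hT : Continuous T) (μ : ProbabilityMeasure X) :
    MeasurePreserving T (μ : Measure X) μ ↔ μ.map hT.measurable.aemeasurable = μ := by
  constructor
  · intro h
    exact Subtype.ext h.map_eq
  · intro h
    exact ⟨hT.measurable, congrArg Subtype.val h⟩

/-- Generic points of a measure in `M` lie in `E`. -/
lemma generic_subset (T : X → X) (hT : Continuous T) {r : ℕ}
    (Φ : (Fin r → X) → WeakDual ℝ B) (hΦ : Continuous Φ) (α : WeakDual ℝ B) (W : Set B)
    (μ : Measure X) (hμ : μ ∈ MsetD T Φ α W) :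
    {x | IsGenericPt T μ x} ⊆ EsetD T Φ α W := by
  obtain ⟨hp, hinv, hW⟩ := hμ
  intro x hx w hw
  let ν : ProbabilityMeasure X := ⟨μ, hp⟩
  have h : Tendsto (fun n => empM T n x) atTop (𝓝 ν) := by
    rw [ProbabilityMeasure.tendsto_iff_forall_integral_tendsto]
    intro f
    have := (hx f.toContinuousMap).comp (tendsto_add_atTop_nat 1)
    refine this.congr fun n => ?_
    rw [integral_empM _ _ _ _ f.continuous.measurable]
    rfl
  have h2 := VstatD_tendsto T hT Φ hΦ x w atTop ν ((measurePreserving_iff_map T hT ν).1 hinv) h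
  have h3 : Tendsto (fun n => VstatD T Φ n x w) atTop
      (𝓝 (∫ y, Φ y w ∂(Measure.pi fun _ : Fin r => μ))) := (tendsto_add_atTop_iff_nat 1).1 h2
  rw [h3.limsup_eq]
  exact hW w hw

/-- Limit points of empirical measures of points of `E` lie in `M`. -/
lemma limit_mem (T : X → X) (hT : Continuous T) {r : ℕ}
    (Φ : (Fin r → X) → WeakDual ℝ B) (hΦ : Continuous Φ) (α : WeakDual ℝ B) (W : Set B)
    (x : X) (hx : x ∈ EsetD T Φ α W) (l : Filter ℕ) [l.NeBot] (hl : l ≤ atTop)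
    (μ : ProbabilityMeasure X) (h : Tendsto (fun n => empM T n x) l (𝓝 μ)) :
    (μ : Measure X) ∈ MsetD T Φ α W := by
  have hinv := empM_tendsto_invariant T hT x l hl μ h
  refine ⟨inferInstance, (measurePreserving_iff_map T hT μ).2 hinv, fun w hw => ?_⟩
  have h2 := VstatD_tendsto T hT Φ hΦ x w l μ hinv h
  have hc : Continuous fun y => Φ y w := (WeakDual.eval_continuous w).comp hΦ
  have hbd : IsBoundedUnder (· ≤ ·) atTop (fun n => VstatD T Φ n x w) := by
    let f : C(ProbabilityMeasure X, ℝ) := ⟨_, continuous_pi_integral _ hc⟩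
    refine ⟨‖f‖, ?_⟩
    rw [eventually_map]
    filter_upwards [eventually_ge_atTop 1] with n hn
    obtain ⟨k, rfl⟩ : ∃ k, n = k + 1 := ⟨n - 1, by omega⟩
    rw [VstatD_succ T Φ hΦ]
    exact (le_abs_self _).trans (f.norm_coe_le_norm (empM T k (T x)))
  refine le_of_forall_gt_imp_ge_of_dense fun b hb => ?_
  have h3 := eventually_lt_of_limsup_lt (lt_of_le_of_lt (hx w hw) hb) hbd
  have h4 : ∀ᶠ n in l, VstatD T Φ (n + 1) x w < b :=
    hl ((tendsto_add_atTop_nat 1).eventually h3)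
  exact le_of_tendsto h2 (h4.mono fun n hn => hn.le)

lemma isCompact_M (T : X → X) (hT : Continuous T) {r : ℕ}
    (Φ : (Fin r → X) → WeakDual ℝ B) (hΦ : Continuous Φ) (α : WeakDual ℝ B) (W : Set B) :
    IsCompact {μ : ProbabilityMeasure X | (μ : Measure X) ∈ MsetD T Φ α W} := by
  apply IsClosed.isCompact
  have : {μ : ProbabilityMeasure X | (μ : Measure X) ∈ MsetD T Φ α W} =
      {μ | μ.map hT.measurable.aemeasurable = μ} ∩ ⋂ w ∈ W,
        {μ : ProbabilityMeasure X | ∫ y, Φ y w ∂(Measure.pi fun _ : Fin r => (μ : Measure X)) ≤ α w} := by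
    ext μ
    simp only [MsetD, Set.mem_ofPred_eq, Set.mem_inter_iff, Set.mem_iInter,
      measurePreserving_iff_map T hT μ]
    exact ⟨fun h => h.2, fun h => ⟨inferInstance, h⟩⟩
  rw [this]
  refine IsClosed.inter ?_ ?_
  · exact isClosed_eq (ProbabilityMeasure.continuous_map hT) continuous_id
  · refine isClosed_iInter fun w => isClosed_iInter fun _ => ?_
    exact isClosed_le (continuous_pi_integral _ ((WeakDual.eval_continuous w).comp hΦ))
      continuous_const

lemma compact_cover (T : X → X) (hT : Continuous T) (s ε : ℝ) (hε : 0 < ε)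
    (K : Set (ProbabilityMeasure X)) (hK : IsCompact K)
    (h : ∀ μ ∈ K, MeasurePreserving T (μ : Measure X) μ ∧
      hKS T (μ : Measure X) < ENNReal.ofReal s) :
    ∃ U : Set (ProbabilityMeasure X), IsOpen U ∧ K ⊆ U ∧ ∃ C : ℝ, ∀ n : ℕ, ∃ F : Finset X,
      (F.card : ℝ) ≤ C * Real.exp (s * ((n + 1 : ℕ) : ℝ)) ∧
      ∀ x, empM T n x ∈ U → ∃ y ∈ F, x ∈ bowenBall T (n + 1) ε y := by
  classical
  have hl := fun μ : K => local_cover T hT μ (h μ μ.2).1 s ε hε (h μ μ.2).2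
  choose U hU C F hF hcov using hl
  obtain ⟨t, ht⟩ := hK.elim_nhds_subcover' (fun μ hμ => interior (U ⟨μ, hμ⟩))
    (fun μ hμ => interior_mem_nhds.2 (hU ⟨μ, hμ⟩))
  refine ⟨_, isOpen_biUnion fun μ _ => isOpen_interior, ht, ∑ μ ∈ t, C μ, fun n => ?_⟩
  refine ⟨t.biUnion fun μ => F μ n, ?_, ?_⟩
  · calc ((t.biUnion fun μ => F μ n).card : ℝ) ≤ ((∑ μ ∈ t, (F μ n).card : ℕ) : ℝ) := by
          exact_mod_cast Finset.card_biUnion_le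
      _ = ∑ μ ∈ t, ((F μ n).card : ℝ) := by push_cast; rfl
      _ ≤ ∑ μ ∈ t, C μ * Real.exp (s * ((n + 1 : ℕ) : ℝ)) := Finset.sum_le_sum fun μ _ => hF μ n
      _ = _ := by rw [Finset.sum_mul]
  · intro x hx
    simp only [Set.mem_iUnion] at hx
    obtain ⟨μ, hμ, hxμ⟩ := hx
    obtain ⟨y, hy, hxy⟩ := hcov μ n x (interior_subset hxμ)
    exact ⟨y, Finset.mem_biUnion.2 ⟨μ, hμ, hy⟩, hxy⟩

end Global

/-- (Theorem 4.1) For a saturated system, a Banach space `B` with dual `B*`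
(weak* topology), a continuous kernel `Φ : X^r → B*`, `W ⊆ B` and `α ∈ B*`:
if `M_Φ(α, W) ≠ ∅` then `h_top(E_Φ(α, W)) = sup_{μ ∈ M_Φ(α, W)} h_μ`. -/
theorem htop_EsetD_eq_iSup_hKS_of_saturated
    {X : Type*} [MetricSpace X] [CompactSpace X] [MeasurableSpace X] [BorelSpace X]
    {B : Type*} [NormedAddCommGroup B] [NormedSpace ℝ B]
    (T : X → X) (hT : Continuous T) (hsat : Saturated T) (r : ℕ) (hr : 1 ≤ r)
    (Φ : (Fin r → X) → WeakDual ℝ B) (hΦ : Continuous Φ)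
    (α : WeakDual ℝ B) (W : Set B)
    (hM : (MsetD T Φ α W).Nonempty) :
    htop T (EsetD T Φ α W) = ⨆ μ ∈ MsetD T Φ α W, hKS T μ := by
  apply le_antisymm
  · set t : ℝ≥0∞ := ⨆ μ ∈ MsetD T Φ α W, hKS T μ with ht
    obtain ⟨μ0, hμ0⟩ := hM
    have hXne : Nonempty X := by
      by_contra h
      rw [not_nonempty_iff] at h
      have hp := hμ0.1
      have : μ0 Set.univ = 1 := measure_univ
      rw [Set.univ_eq_empty_iff.2 h] at this
      simp at this
    obtain ⟨x0⟩ := hXne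
    refine iSup_le fun ε => iSup_le fun hε => ?_
    refine le_of_forall_gt_imp_ge_of_dense fun b hb => ?_
    obtain ⟨s, hts, hsb⟩ := ENNReal.lt_iff_exists_nnreal_btwn.1 hb
    obtain ⟨s', hts', hss⟩ := ENNReal.lt_iff_exists_nnreal_btwn.1 hts
    have hss' : (s' : ℝ) < s := by exact_mod_cast hss
    refine le_trans ?_ hsb.le
    unfold bowenEnt
    refine iInf_le_of_le s (iInf_le_of_le ?_ le_rfl)
    obtain ⟨U, hUo, hKU, C, hC⟩ := compact_cover T hT s' ε hε _ (isCompact_M T hT Φ hΦ α W)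
      (fun μ hμ => ⟨hμ.2.1, by
        rw [ENNReal.ofReal_coe_nnreal]
        exact lt_of_le_of_lt (le_iSup₂_of_le (μ : Measure X) hμ le_rfl) hts'⟩)
    choose F hF hcov using hC
    refine bowenH_eq_zero T _ x0 s s' ε C s'.2 hss' F hF fun x hx => ?_
    have hev : ∀ᶠ n in atTop, empM T n x ∈ U := by
      by_contra hcon
      have hfr : ∃ᶠ n in atTop, empM T n x ∉ U := not_eventually.1 hcon
      have hne : (atTop ⊓ 𝓟 {n | empM T n x ∉ U}).NeBot := by
        rw [← frequently_mem_iff_neBot]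
        exact hfr
      let u := Ultrafilter.of (atTop ⊓ 𝓟 {n | empM T n x ∉ U})
      have hu : (u : Filter ℕ) ≤ atTop ⊓ 𝓟 {n | empM T n x ∉ U} := Ultrafilter.of_le _
      obtain ⟨μ, -, hμ⟩ := isCompact_univ.ultrafilter_le_nhds (u.map fun n => empM T n x)
        (by simp)
      have hlim : Tendsto (fun n => empM T n x) u (𝓝 μ) := hμ
      have hmem := limit_mem T hT Φ hΦ α W x hx u (hu.trans inf_le_left) μ hlim
      have h1 : ∀ᶠ n in (u : Filter ℕ), empM T n x ∈ U :=
        hlim.eventually (hUo.mem_nhds (hKU hmem))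
      have h2 : ∀ᶠ n in (u : Filter ℕ), empM T n x ∉ U :=
        (hu.trans inf_le_right) (mem_principal_self _)
      obtain ⟨n, hn1, hn2⟩ := (h1.and h2).exists
      exact hn2 hn1
    exact (hev.mono fun n hn => hcov n x hn).frequently
  · refine iSup₂_le fun μ hμ => ?_
    rw [← hsat μ hμ.1 hμ.2.1]
    exact htop_mono T (generic_subset T hT Φ hΦ α W μ hμ)
end

section
/- Let (X,T) = (Σ_m, σ) be the full shift on m ≥ 2 symbols, B a real Banach space with dual B*, r ≥ 1, Φ : Σ_m^r → B* continuous (B* carrying the weak* topology), and W ⊂ B. Let L_{(Φ,W)} = {α ∈ B* : E_Φ(α,W) ≠ ∅} and define f_{(Φ,W)}(α) = h_top(E_Φ(α,W)). Then f_{(Φ,W)} : L_{(Φ,W)} → ℝ is upper semi-continuous (with respect to the weak* topology on B*). -/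
open MeasureTheory Filter Topology
open scoped ENNReal NNReal

section Shift

/- The metric `d(x,y) = (1/2)^{min {n : x_n ≠ y_n}}` on the symbolic space
`Σ_m = {0, …, m-1}^ℕ`; its topology is the product topology. -/
attribute [local instance] PiNat.metricSpace

/-- The shift map `σ` on `Σ_m = {0, …, m-1}^ℕ`. -/
def shift (m : ℕ) : (ℕ → Fin m) → (ℕ → Fin m) := fun x n => x (n + 1)

/-- Words over the alphabet. -/
abbrev Wd (m : ℕ) := Σ k : ℕ, (Fin k → Fin m)

/-- Restriction to the first `n` coordinates. -/
def resW (m n : ℕ) (x : ℕ → Fin m) : Fin n → Fin m := fun i => x i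

/-- Frequencies of words along the orbit. -/
noncomputable def fq (m n : ℕ) (x : ℕ → Fin m) (v : Wd m) : ℝ :=
  (∑ i : Fin n, if resW m v.1 ((shift m)^[(i : ℕ) + 1] x) = v.2 then (1 : ℝ) else 0) / n

lemma shift_iter (m n : ℕ) (x : ℕ → Fin m) (j : ℕ) : (shift m)^[n] x j = x (n + j) := by
  induction n generalizing x with
  | zero => simp
  | succ n ih =>
    rw [Function.iterate_succ_apply, ih]
    simp only [shift]
    congr 1
    omega

lemma fq_mem (m n : ℕ) (x : ℕ → Fin m) :
    fq m n x ∈ Set.pi Set.univ (fun _ : Wd m => Set.Icc (0 : ℝ) 1) := by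
  intro v _
  have h0 : (0 : ℝ) ≤ ∑ i : Fin n,
      if resW m v.1 ((shift m)^[(i : ℕ) + 1] x) = v.2 then (1 : ℝ) else 0 :=
    Finset.sum_nonneg (fun i _ => by split_ifs <;> norm_num)
  have h1 : (∑ i : Fin n,
      if resW m v.1 ((shift m)^[(i : ℕ) + 1] x) = v.2 then (1 : ℝ) else 0) ≤ n := by
    calc _ ≤ ∑ i : Fin n, (1 : ℝ) :=
          Finset.sum_le_sum (fun i _ => by split_ifs <;> norm_num)
      _ = n := by simp
  refine ⟨div_nonneg h0 (by positivity), div_le_one_of_le₀ h1 (by positivity)⟩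

lemma exists_unif (m r : ℕ) (ψ : (Fin r → (ℕ → Fin m)) → ℝ) (hψ : Continuous ψ)
    (δ : ℝ) (hδ : 0 < δ) :
    ∃ k : ℕ, ∀ z z' : Fin r → (ℕ → Fin m), (∀ j, resW m k (z j) = resW m k (z' j)) →
      |ψ z - ψ z'| ≤ δ := by
  have hu := CompactSpace.uniformContinuous_of_continuous hψ
  rw [Metric.uniformContinuous_iff] at hu
  obtain ⟨η, hη, h⟩ := hu δ hδ
  obtain ⟨k, hk⟩ := exists_pow_lt_of_lt_one hη (by norm_num : (1 / 2 : ℝ) < 1)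
  refine ⟨k, fun z z' hz => ?_⟩
  have : dist z z' < η := by
    rw [dist_pi_lt_iff hη]
    intro j
    refine lt_of_le_of_lt ?_ hk
    apply PiNat.mem_cylinder_iff_dist_le.1
    intro i hi
    exact congrFun (hz j) ⟨i, hi⟩
  have := h this
  rw [Real.dist_eq] at this
  exact this.le

lemma exists_approx (m : ℕ) (hm : 2 ≤ m) {B : Type*} [NormedAddCommGroup B] [NormedSpace ℝ B]
    (r : ℕ) (Φ : (Fin r → (ℕ → Fin m)) → WeakDual ℝ B) (hΦ : Continuous Φ)
    (w : B) (δ : ℝ) (hδ : 0 < δ) :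
    ∃ G : (Wd m → ℝ) → ℝ, Continuous G ∧ ∀ n, 1 ≤ n → ∀ x,
      |VstatD (shift m) Φ n x w - G (fq m n x)| ≤ δ := by
  have hψ : Continuous (fun z => Φ z w) := (WeakDual.eval_continuous w).comp hΦ
  obtain ⟨k, hk⟩ := exists_unif m r _ hψ δ hδ
  let rep : (Fin k → Fin m) → (ℕ → Fin m) := fun v i =>
    if h : i < k then v ⟨i, h⟩ else ⟨0, by omega⟩
  have hrep : ∀ v, resW m k (rep v) = v := by
    intro v; funext i; simp [resW, rep]
  refine ⟨fun y => ∑ v : Fin r → (Fin k → Fin m), Φ (fun j => rep (v j)) w *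
    ∏ j, y ⟨k, v j⟩, ?_, ?_⟩
  · fun_prop
  intro n hn x
  have hn' : (0 : ℝ) < (n : ℝ) ^ r := by positivity
  have e1 : VstatD (shift m) Φ n x w = ((n : ℝ) ^ r)⁻¹ *
      ∑ i : Fin r → Fin n, Φ (fun j => (shift m)^[(i j : ℕ) + 1] x) w := by
    unfold VstatD
    have : ∀ (c : ℝ) (s : Finset (Fin r → Fin n)) (f : (Fin r → Fin n) → WeakDual ℝ B),
        (c • ∑ i ∈ s, f i) w = c * ∑ i ∈ s, f i w := by
      intro c s f
      have h2 : (∑ i ∈ s, f i) w = ∑ i ∈ s, f i w := by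
        classical
        induction s using Finset.induction_on with
        | empty => simp; rfl
        | insert a s ha ih => rw [Finset.sum_insert ha, Finset.sum_insert ha, ← ih]; rfl
      rw [← h2]; rfl
    exact this _ _ _
  have e2 : (∑ v : Fin r → (Fin k → Fin m), Φ (fun j => rep (v j)) w *
      ∏ j, fq m n x ⟨k, v j⟩) = ((n : ℝ) ^ r)⁻¹ *
      ∑ i : Fin r → Fin n, Φ (fun j => rep (resW m k ((shift m)^[(i j : ℕ) + 1] x))) w := by
    have e3 : ∀ v : Fin r → (Fin k → Fin m), ∏ j, fq m n x ⟨k, v j⟩ = ((n : ℝ) ^ r)⁻¹ *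
        ∑ i : Fin r → Fin n,
          if (fun j => resW m k ((shift m)^[(i j : ℕ) + 1] x)) = v then (1 : ℝ) else 0 := by
      intro v
      unfold fq
      rw [Finset.prod_div_distrib, Finset.prod_univ_sum]
      simp only [Finset.prod_const, Finset.card_univ, Fintype.card_fin, Fintype.piFinset_univ]
      rw [div_eq_inv_mul]
      congr 1
      refine Finset.sum_congr rfl fun i _ => ?_
      rw [Finset.prod_ite_zero]
      simp [funext_iff]
    simp_rw [e3, ← mul_assoc, mul_comm _ ((n : ℝ) ^ r)⁻¹, mul_assoc, ← Finset.mul_sum]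
    congr 1
    simp_rw [Finset.mul_sum]
    rw [Finset.sum_comm]
    refine Finset.sum_congr rfl fun i _ => ?_
    rw [Finset.sum_eq_single (fun j => resW m k ((shift m)^[(i j : ℕ) + 1] x))]
    · rw [if_pos rfl, mul_one]
    · intro b _ hb
      rw [if_neg (Ne.symm hb), mul_zero]
    · intro h
      exact absurd (Finset.mem_univ _) h
  show |_ - ∑ v : Fin r → (Fin k → Fin m), Φ (fun j => rep (v j)) w *
      ∏ j, fq m n x ⟨k, v j⟩| ≤ δ
  rw [e1, e2, ← mul_sub, ← Finset.sum_sub_distrib, abs_mul, abs_of_pos (inv_pos.2 hn'),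
    inv_mul_le_iff₀ hn']
  refine (Finset.abs_sum_le_sum_abs _ _).trans ?_
  calc _ ≤ ∑ i : Fin r → Fin n, δ := by
        refine Finset.sum_le_sum fun i _ => hk _ _ fun j => ?_
        rw [hrep]
    _ = _ := by simp

lemma Vstat_bdd (m : ℕ) (hm : 2 ≤ m) {B : Type*} [NormedAddCommGroup B] [NormedSpace ℝ B]
    (r : ℕ) (Φ : (Fin r → (ℕ → Fin m)) → WeakDual ℝ B) (hΦ : Continuous Φ)
    (w : B) : ∃ C, ∀ n, 1 ≤ n → ∀ x, |VstatD (shift m) Φ n x w| ≤ C := by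
  obtain ⟨G, hG, h⟩ := exists_approx m hm r Φ hΦ w 1 one_pos
  have hc : IsCompact (Set.pi Set.univ (fun _ : Wd m => Set.Icc (0 : ℝ) 1)) :=
    isCompact_univ_pi fun _ => isCompact_Icc
  obtain ⟨C, hC⟩ := hc.exists_bound_of_continuousOn hG.continuousOn
  refine ⟨1 + C, fun n hn x => ?_⟩
  have h1 := h n hn x
  have h2 := hC _ (fq_mem m n x)
  rw [Real.norm_eq_abs] at h2
  have := abs_sub_abs_le_abs_sub (VstatD (shift m) Φ n x w) (G (fq m n x))
  linarith

/-- Number of words of length `n` realizing frequencies in `U`. -/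
noncomputable def cnt (m : ℕ) (U : Set (Wd m → ℝ)) (n : ℕ) : ℕ :=
  (resW m n '' {x | fq m n x ∈ U}).ncard

/-- Exponential growth rate at most `s`. -/
def SmallRate (m : ℕ) (U : Set (Wd m → ℝ)) (s : ℝ) : Prop :=
  ∃ C : ℝ, 0 ≤ C ∧ ∀ᶠ n : ℕ in atTop, (cnt m U n : ℝ) ≤ C * Real.exp (s * n)

lemma SmallRate.union {m : ℕ} {U V : Set (Wd m → ℝ)} {s : ℝ} (hU : SmallRate m U s) (hV : SmallRate m V s) :
    SmallRate m (U ∪ V) s := by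
  obtain ⟨C, hC, h⟩ := hU
  obtain ⟨D, hD, h'⟩ := hV
  refine ⟨C + D, by positivity, ?_⟩
  filter_upwards [h, h'] with n h1 h2
  have : cnt m (U ∪ V) n ≤ cnt m U n + cnt m V n := by
    unfold cnt
    have : {x | fq m n x ∈ U ∪ V} = {x | fq m n x ∈ U} ∪ {x | fq m n x ∈ V} := rfl
    rw [this, Set.image_union]
    exact Set.ncard_union_le _ _
  have : (cnt m (U ∪ V) n : ℝ) ≤ cnt m U n + cnt m V n := by exact_mod_cast this
  linarith

lemma exists_cover (m : ℕ) (U : Set (Wd m → ℝ)) (n : ℕ) (x₀ : ℕ → Fin m) :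
    ∃ T : Finset (ℕ → Fin m), x₀ ∈ T ∧ T.card ≤ cnt m U n + 1 ∧
      ∀ x, fq m n x ∈ U → ∃ z ∈ T, resW m n z = resW m n x := by
  classical
  have hfin : (resW m n '' {x | fq m n x ∈ U}).Finite := Set.toFinite _
  have hch : ∀ u : Fin n → Fin m, ∃ z : ℕ → Fin m,
      u ∈ resW m n '' {x | fq m n x ∈ U} → resW m n z = u := by
    intro u
    by_cases hu : u ∈ resW m n '' {x | fq m n x ∈ U}
    · obtain ⟨z, _, hz⟩ := hu
      exact ⟨z, fun _ => hz⟩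
    · exact ⟨x₀, fun h => absurd h hu⟩
  choose g hg using hch
  refine ⟨insert x₀ (hfin.toFinset.image g), Finset.mem_insert_self _ _, ?_, ?_⟩
  · refine (Finset.card_insert_le _ _).trans ?_
    gcongr
    refine Finset.card_image_le.trans ?_
    rw [cnt, Set.ncard_eq_toFinset_card _ hfin]
  · intro x hx
    have : resW m n x ∈ resW m n '' {x | fq m n x ∈ U} := ⟨x, hx, rfl⟩
    exact ⟨g (resW m n x), Finset.mem_insert_of_mem
      (Finset.mem_image_of_mem _ (hfin.mem_toFinset.2 this)), hg _ this⟩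

lemma mem_bowenBall_of_res (m n k : ℕ) (ε : ℝ) (hk : (1 / 2 : ℝ) ^ k < ε) (x z : ℕ → Fin m)
    (h : resW m (n + k) z = resW m (n + k) x) : x ∈ bowenBall (shift m) n ε z := by
  intro j hj
  refine lt_of_le_of_lt ?_ hk
  apply PiNat.mem_cylinder_iff_dist_le.1
  intro i hi
  rw [shift_iter, shift_iter]
  exact congrFun h ⟨j + i, by omega⟩

lemma bowenHn_le_of_cover_s7 {m : ℕ} (Z : Set (ℕ → Fin m)) (s ε : ℝ) (N : ℕ)
    (T : ℕ → Finset (ℕ → Fin m)) (hT : ∀ n, (T n).Nonempty)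
    (hZ : ∀ x ∈ Z, ∃ n, ∃ z ∈ T n, x ∈ bowenBall (shift m) (N + n) ε z) :
    bowenHn (shift m) Z s ε N ≤
      ∑' n, ((T n).card : ℝ≥0∞) * ENNReal.ofReal (Real.exp (-(s * ((N + n : ℕ) : ℝ)))) := by
  have : ∀ n, Nonempty (T n) := fun n => (hT n).to_subtype
  have hinf : Infinite (Σ n, T n) :=
    Infinite.of_surjective (fun p : (Σ n, T n) => p.1) (fun n => ⟨⟨n, Classical.arbitrary _⟩, rfl⟩)
  obtain ⟨e⟩ : Nonempty (ℕ ≃ Σ n, T n) := by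
    obtain ⟨d⟩ := nonempty_denumerable (Σ n, T n)
    exact ⟨(Denumerable.eqv _).symm⟩
  let c : ℕ → (ℕ → Fin m) × ℕ := fun i => ((e i).2.1, N + (e i).1)
  have hc1 : Z ⊆ ⋃ i, bowenBall (shift m) (c i).2 ε (c i).1 := by
    intro x hx
    obtain ⟨n, z, hz, hb⟩ := hZ x hx
    refine Set.mem_iUnion.2 ⟨e.symm ⟨n, z, hz⟩, ?_⟩
    have he : e (e.symm ⟨n, z, hz⟩) = ⟨n, z, hz⟩ := e.apply_symm_apply _
    show x ∈ bowenBall (shift m) (N + (e (e.symm ⟨n, z, hz⟩)).1) ε (e (e.symm ⟨n, z, hz⟩)).2.1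
    rw [he]
    exact hb
  have hc2 : ∀ i, N ≤ (c i).2 := fun i => Nat.le_add_right _ _
  unfold bowenHn
  refine iInf_le_of_le c (iInf_le_of_le hc1 (iInf_le_of_le hc2 ?_))
  have := e.tsum_eq (fun p : (Σ n, T n) => ENNReal.ofReal (Real.exp (-(s * ((N + p.1 : ℕ) : ℝ)))))
  show ∑' i, ENNReal.ofReal (Real.exp (-(s * ((N + (e i).1 : ℕ) : ℝ)))) ≤ _
  rw [this, ENNReal.tsum_sigma']
  refine le_of_eq (tsum_congr fun n => ?_)
  simp

lemma bowenHn_mono {m : ℕ} (Z : Set (ℕ → Fin m)) (s ε : ℝ) {N N' : ℕ} (h : N ≤ N') :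
    bowenHn (shift m) Z s ε N ≤ bowenHn (shift m) Z s ε N' := by
  unfold bowenHn
  refine iInf_mono fun c => iInf_mono fun _ => ?_
  exact le_iInf fun h' => iInf_le_of_le (fun i => h.trans (h' i)) le_rfl

lemma htop_le_of_small (m : ℕ) (hm : 2 ≤ m) (U : Set (Wd m → ℝ)) (s : ℝ≥0) (hU : SmallRate m U s)
    (Z : Set (ℕ → Fin m)) (hZ : ∀ x ∈ Z, ∀ᶠ n in atTop, fq m n x ∈ U) :
    htop (shift m) Z ≤ s := by
  obtain ⟨C, hC, hcnt⟩ := hU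
  refine iSup₂_le fun ε hε => ?_
  refine le_of_forall_gt_imp_ge_of_dense fun a ha => ?_
  obtain ⟨t, hst, hta⟩ := ENNReal.lt_iff_exists_nnreal_btwn.1 ha
  refine le_trans ?_ hta.le
  have hst : (s : ℝ) < t := by exact_mod_cast hst
  refine iInf₂_le t ?_
  obtain ⟨k, hk⟩ := exists_pow_lt_of_lt_one hε (by norm_num : (1 / 2 : ℝ) < 1)
  have x₀ : ℕ → Fin m := fun _ => ⟨0, by omega⟩
  choose T hT0 hTc hTx using fun n => exists_cover m U n x₀
  obtain ⟨N₀, hN₀⟩ := eventually_atTop.1 hcnt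
  set D : ℝ := (C + 1) * Real.exp (s * k) with hD
  have hDpos : 0 < D := by positivity
  set q : ℝ := Real.exp (-(t - s)) with hq
  have hq0 : 0 < q := Real.exp_pos _
  have hq1 : q < 1 := by rw [hq, Real.exp_lt_one_iff]; linarith
  have key : ∀ N, N₀ ≤ N → bowenHn (shift m) Z t ε N ≤ ENNReal.ofReal (D * q ^ N * (1 - q)⁻¹) := by
    intro N hN
    refine (bowenHn_le_of_cover_s7 Z t ε N (fun n => T (N + n + k)) (fun n => ⟨_, hT0 _⟩) ?_).trans ?_
    · intro x hx
      obtain ⟨M, hM⟩ := eventually_atTop.1 (hZ x hx)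
      obtain ⟨z, hz, hzx⟩ := hTx (N + M + k) x (hM _ (by omega))
      exact ⟨M, z, hz, mem_bowenBall_of_res m _ k ε hk x z hzx⟩
    · have hs : HasSum (fun n : ℕ => D * q ^ N * q ^ n) (D * q ^ N * (1 - q)⁻¹) :=
        (hasSum_geometric_of_lt_one hq0.le hq1).mul_left _
      rw [← hs.tsum_eq, ENNReal.ofReal_tsum_of_nonneg (fun n => by positivity) hs.summable]
      refine ENNReal.tsum_le_tsum fun n => ?_
      rw [← ENNReal.ofReal_natCast, ← ENNReal.ofReal_mul (by positivity)]
      refine ENNReal.ofReal_le_ofReal ?_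
      have h1 : ((T (N + n + k)).card : ℝ) ≤ cnt m U (N + n + k) + 1 := by exact_mod_cast hTc _
      have h2 := hN₀ (N + n + k) (by omega)
      have h3 : (1 : ℝ) ≤ Real.exp (s * ((N + n + k : ℕ) : ℝ)) := by
        rw [Real.one_le_exp_iff]; positivity
      have h4 : ((T (N + n + k)).card : ℝ) ≤ (C + 1) * Real.exp (s * ((N + n + k : ℕ) : ℝ)) := by
        linarith
      calc _ ≤ (C + 1) * Real.exp (s * ((N + n + k : ℕ) : ℝ)) *
            Real.exp (-(t * ((N + n : ℕ) : ℝ))) := by gcongr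
        _ = D * q ^ N * q ^ n := by
          rw [hD, hq, mul_assoc, mul_assoc, mul_assoc, ← pow_add, ← Real.exp_nat_mul,
            ← Real.exp_add, ← Real.exp_add]
          congr 2
          push_cast
          ring
  have hlim : Tendsto (fun N : ℕ => ENNReal.ofReal (D * q ^ N * (1 - q)⁻¹)) atTop (𝓝 0) := by
    rw [← ENNReal.ofReal_zero]
    refine ENNReal.tendsto_ofReal ?_
    have := ((tendsto_pow_atTop_nhds_zero_of_lt_one hq0.le hq1).const_mul D).mul_const (1 - q)⁻¹
    simpa using this
  refine le_antisymm (iSup_le fun N => ?_) zero_le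
  refine ge_of_tendsto hlim ?_
  filter_upwards [eventually_ge_atTop N, eventually_ge_atTop N₀] with N' h1 h2
  exact (bowenHn_mono Z t ε h1).trans (key N' h2)

lemma exists_block (b : ℕ → ℕ) (hb0 : b 0 = 0) (hb : StrictMono b) (n : ℕ) :
    ∃ j, b j ≤ n ∧ n < b (j + 1) := by
  induction n with
  | zero => exact ⟨0, by omega, by have := hb (Nat.lt_succ_self 0); simp at this ⊢; omega⟩
  | succ n ih =>
    obtain ⟨j, h1, h2⟩ := ih
    by_cases h : n + 1 < b (j + 1)
    · exact ⟨j, by omega, h⟩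
    · exact ⟨j + 1, by omega, by have := hb (Nat.lt_succ_self (j + 1)); simp at this ⊢; omega⟩

lemma block_unique (b : ℕ → ℕ) (hb : StrictMono b) {n j j' : ℕ} (h1 : b j ≤ n)
    (h2 : n < b (j + 1)) (h1' : b j' ≤ n) (h2' : n < b (j' + 1)) : j = j' := by
  have a : j < j' + 1 := hb.lt_iff_lt.1 (lt_of_le_of_lt h1 h2')
  have c : j' < j + 1 := hb.lt_iff_lt.1 (lt_of_le_of_lt h1' h2)
  omega

lemma exists_concat {m : ℕ} (ℓ b : ℕ → ℕ) (hb0 : b 0 = 0) (hb : StrictMono b)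
    (hℓ : ∀ j, b (j + 1) = b j + ℓ j) (z : ℕ → (ℕ → Fin m)) :
    ∃ x : ℕ → Fin m, ∀ j i, i < ℓ j → x (b j + i) = z j i := by
  choose J hJ1 hJ2 using exists_block b hb0 hb
  refine ⟨fun n => z (J n) (n - b (J n)), fun j i hi => ?_⟩
  have : J (b j + i) = j := block_unique b hb (hJ1 _) (hJ2 _) (by omega) (by rw [hℓ]; omega)
  simp [this]

lemma mass (m : ℕ) (M ℓ b : ℕ → ℕ) (hM : ∀ j, 0 < M j) (hb0 : b 0 = 0) (hb : StrictMono b)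
    (hℓ : ∀ j, b (j + 1) = b j + ℓ j) (g : ∀ j, Fin (M j) → (ℕ → Fin m))
    (hg : ∀ j a a', resW m (ℓ j) (g j a) = resW m (ℓ j) (g j a') → a = a')
    (s t : ℝ≥0) (hMs : ∀ j, Real.exp (s * ℓ j) ≤ M j) (J : ℕ)
    (hJ : ∀ j, J ≤ j → (t : ℝ) * b (j + 1) ≤ s * b j) (Z : Set (ℕ → Fin m))
    (hZ : ∀ x (ω : ∀ j, Fin (M j)), (∀ j i, i < ℓ j → x (b j + i) = g j (ω j) i) → x ∈ Z) :
    bowenH (shift m) Z t 1 ≠ 0 := by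
  intro h0
  have h1 : bowenHn (shift m) Z t 1 (b J) < 1 := by
    refine lt_of_le_of_lt (le_iSup (fun n => bowenHn (shift m) Z t 1 n) (b J)) ?_
    show bowenH (shift m) Z t 1 < 1
    rw [h0]; exact one_pos
  unfold bowenHn at h1
  simp only [iInf_lt_iff] at h1
  obtain ⟨c, hc, hcn, hsum⟩ := h1
  have : ∀ j, Nonempty (Fin (M j)) := fun j => ⟨⟨0, hM j⟩⟩
  choose x hx using fun ω : (∀ j, Fin (M j)) =>
    exists_concat ℓ b hb0 hb hℓ (fun j => g j (ω j))
  let P : Measure (∀ j, Fin (M j)) :=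
    Measure.infinitePi (fun j => (PMF.uniformOfFintype (Fin (M j))).toMeasure)
  have hcov : (Set.univ : Set (∀ j, Fin (M j))) ⊆
      ⋃ i, {ω | x ω ∈ bowenBall (shift m) (c i).2 1 (c i).1} := by
    intro ω _
    obtain ⟨i, hi⟩ := Set.mem_iUnion.1 (hc (hZ (x ω) ω (hx ω)))
    exact Set.mem_iUnion.2 ⟨i, hi⟩
  have hP : ∀ i, P {ω | x ω ∈ bowenBall (shift m) (c i).2 1 (c i).1} ≤
      ENNReal.ofReal (Real.exp (-(t * ((c i).2 : ℝ)))) := by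
    intro i
    obtain ⟨j, hj1, hj2⟩ := exists_block b hb0 hb (c i).2
    have hJj : J ≤ j := by
      have := hb.lt_iff_lt.1 (lt_of_le_of_lt (hcn i) hj2)
      omega
    let S : ∀ k, Set (Fin (M k)) := fun k =>
      {a | resW m (ℓ k) (g k a) = fun p : Fin (ℓ k) => (c i).1 (b k + p)}
    have hsub : {ω | x ω ∈ bowenBall (shift m) (c i).2 1 (c i).1} ⊆
        Set.pi (Finset.range j : Set ℕ) S := by
      intro ω hω k hk
      have hk : k < j := by simpa using hk
      show resW m (ℓ k) (g k (ω k)) = fun p : Fin (ℓ k) => (c i).1 (b k + p)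
      funext p
      have hbk : b (k + 1) ≤ b j := hb.monotone hk
      have h2 := hω (b k + p) (by have := hℓ k; have := p.2; omega)
      have h3 := PiNat.apply_eq_of_dist_lt (n := 0) (by simpa using h2) le_rfl
      rw [shift_iter, shift_iter, add_zero, hx ω k p p.2] at h3
      exact h3.symm
    refine (measure_mono hsub).trans ?_
    rw [Measure.infinitePi_pi _ (fun k _ => MeasurableSet.of_discrete)]
    have hS : ∀ k, (PMF.uniformOfFintype (Fin (M k))).toMeasure (S k) ≤
        ENNReal.ofReal (Real.exp (-(s * ℓ k))) := by
      intro k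
      by_cases hne : (S k).Nonempty
      · obtain ⟨a, ha⟩ := hne
        have : S k ⊆ {a} := by
          intro a' ha'
          exact hg k a' a (Eq.trans ha' (Eq.symm ha))
        refine (measure_mono this).trans ?_
        rw [PMF.toMeasure_apply_singleton _ _ (measurableSet_singleton a),
          PMF.uniformOfFintype_apply, Fintype.card_fin, Real.exp_neg,
          ENNReal.ofReal_inv_of_pos (Real.exp_pos _), ENNReal.inv_le_inv]
        rw [← ENNReal.ofReal_natCast]
        exact ENNReal.ofReal_le_ofReal (hMs k)
      · rw [Set.not_nonempty_iff_eq_empty.1 hne]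
        simp
    refine (Finset.prod_le_prod' (fun k _ => hS k)).trans ?_
    rw [← ENNReal.ofReal_prod_of_nonneg (fun _ _ => (Real.exp_pos _).le), ← Real.exp_sum]
    refine ENNReal.ofReal_le_ofReal (Real.exp_le_exp.2 ?_)
    have hbsum : ∀ j, ∑ k ∈ Finset.range j, -((s : ℝ) * ℓ k) = -(s * b j) := by
      intro j
      induction j with
      | zero => simp [hb0]
      | succ j ih => rw [Finset.sum_range_succ, ih, hℓ]; push_cast; ring
    rw [hbsum]
    have h4 := hJ j hJj
    have h5 : ((c i).2 : ℝ) ≤ b (j + 1) := by exact_mod_cast hj2.le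
    have h6 : (t : ℝ) * (c i).2 ≤ t * b (j + 1) := by gcongr
    linarith
  have hone : P Set.univ = 1 := measure_univ
  have : (1 : ℝ≥0∞) < 1 := by
    calc (1 : ℝ≥0∞) = P Set.univ := hone.symm
      _ ≤ P (⋃ i, {ω | x ω ∈ bowenBall (shift m) (c i).2 1 (c i).1}) := measure_mono hcov
      _ ≤ ∑' i, P {ω | x ω ∈ bowenBall (shift m) (c i).2 1 (c i).1} := measure_iUnion_le _
      _ ≤ ∑' i, ENNReal.ofReal (Real.exp (-(t * ((c i).2 : ℝ)))) := ENNReal.tsum_le_tsum hP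
      _ < 1 := hsum
  exact lt_irrefl _ this

lemma avg_tendsto (D : ℕ → ℝ) (b : ℕ → ℕ) (hb0 : b 0 = 0) (hb : StrictMono b) (C : ℝ)
    (hC : 0 ≤ C) (hD : ∀ n, |D (n + 1) - D n| ≤ C)
    (h1 : ∀ ε > 0, ∃ J, ∀ j ≥ J, |D (b (j + 1)) - D (b j)| ≤ ε * (b (j + 1) - b j : ℝ))
    (h2 : ∀ ε > 0, ∃ J, ∀ j ≥ J, (b (j + 1) - b j : ℝ) ≤ ε * b j) :
    Tendsto (fun n : ℕ => D n / n) atTop (𝓝 0) := by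
  have hstep : ∀ n k, |D (n + k) - D n| ≤ C * k := by
    intro n k
    induction k with
    | zero => simp
    | succ k ih =>
      have := hD (n + k)
      have h3 := abs_add_le (D (n + k + 1) - D (n + k)) (D (n + k) - D n)
      rw [sub_add_sub_cancel] at h3
      push_cast
      rw [← add_assoc]
      linarith
  rw [Metric.tendsto_atTop]
  intro ε hε
  obtain ⟨η, hη, hηε⟩ : ∃ η > 0, (2 + C) * η < ε := by
    refine ⟨ε / (2 * (2 + C)), by positivity, ?_⟩
    have : 0 < 2 + C := by positivity
    field_simp
    linarith
  obtain ⟨J1, hJ1⟩ := h1 η hη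
  obtain ⟨J2, hJ2⟩ := h2 η hη
  set J := max J1 J2
  have hmain : ∀ k, |D (b (J + k))| ≤ |D (b J)| + η * b (J + k) := by
    intro k
    induction k with
    | zero => simp; positivity
    | succ k ih =>
      have h3 := hJ1 (J + k) (by omega)
      have h4 := abs_add_le (D (b (J + k + 1)) - D (b (J + k))) (D (b (J + k)))
      rw [sub_add_cancel] at h4
      rw [← add_assoc]
      linarith
  obtain ⟨N, hN⟩ := exists_nat_gt (|D (b J)| / η)
  refine ⟨max (N + 1) (b J), fun n hn => ?_⟩
  obtain ⟨j, hj1, hj2⟩ := exists_block b hb0 hb n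
  have hJj : J ≤ j := by
    have := hb.lt_iff_lt.1 (lt_of_le_of_lt ((le_max_right _ _).trans hn) hj2)
    omega
  obtain ⟨k, rfl⟩ := Nat.exists_eq_add_of_le hJj
  obtain ⟨p, rfl⟩ := Nat.exists_eq_add_of_le hj1
  have e1 := hmain k
  have e2 := hstep (b (J + k)) p
  have e3 := hJ2 (J + k) (by omega)
  have hp : (p : ℝ) ≤ b (J + k + 1) - b (J + k) := by
    have : ((b (J + k) + p : ℕ) : ℝ) ≤ b (J + k + 1) := by exact_mod_cast hj2.le
    push_cast at this; linarith
  have hnN : (N : ℝ) + 1 ≤ ((b (J + k) + p : ℕ) : ℝ) := by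
    exact_mod_cast (le_max_left _ _).trans hn
  set n := b (J + k) + p with hn
  have hnpos : (0 : ℝ) < n := by
    have : (0 : ℝ) ≤ N := by positivity
    linarith
  have hbn : (b (J + k) : ℝ) ≤ n := by exact_mod_cast hj1
  have e4 : |D (b J)| ≤ η * n := by
    rw [div_lt_iff₀ hη] at hN
    nlinarith
  have e5 : C * p ≤ C * (η * n) := by
    gcongr
    nlinarith
  have e6 : η * b (J + k) ≤ η * n := by gcongr
  have e7 := abs_add_le (D n - D (b (J + k))) (D (b (J + k)))
  rw [sub_add_cancel] at e7
  rw [Real.dist_eq, sub_zero, abs_div, abs_of_pos hnpos, div_lt_iff₀ hnpos]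
  have : (2 + C) * η * n < ε * n := by gcongr
  nlinarith

lemma sum_bdry (d : ℕ → ℝ) (q l : ℕ) (h1 : ∀ i, d i ≤ 1) (h0 : ∀ i, i + q < l → d i ≤ 0) :
    ∑ i ∈ Finset.range l, d i ≤ q := by
  rcases le_total l q with h | h
  · calc _ ≤ ∑ i ∈ Finset.range l, (1 : ℝ) := Finset.sum_le_sum fun i _ => h1 i
      _ = l := by simp
      _ ≤ q := by exact_mod_cast h
  · obtain ⟨p, rfl⟩ := Nat.exists_eq_add_of_le h
    rw [add_comm q p, Finset.sum_range_add]
    have e1 : ∑ i ∈ Finset.range p, d i ≤ 0 :=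
      Finset.sum_nonpos fun i hi => h0 i (by have := Finset.mem_range.1 hi; omega)
    have e2 : ∑ i ∈ Finset.range q, d (p + i) ≤ q := by
      calc _ ≤ ∑ i ∈ Finset.range q, (1 : ℝ) := Finset.sum_le_sum fun i _ => h1 _
        _ = q := by simp
    linarith

/-- The generic points of a frequency vector. -/
def Gen (m : ℕ) (y : Wd m → ℝ) : Set (ℕ → Fin m) :=
  {x | Tendsto (fun n => fq m n x) atTop (𝓝 y)}

lemma concat_gen (m : ℕ) (ℓ b : ℕ → ℕ) (hb0 : b 0 = 0) (hb : StrictMono b)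
    (hℓ : ∀ j, b (j + 1) = b j + ℓ j) (hℓtop : Tendsto ℓ atTop atTop)
    (hsmall : ∀ ε > 0, ∃ J, ∀ j ≥ J, (ℓ j : ℝ) ≤ ε * b j)
    (y : Wd m → ℝ) (z : ℕ → (ℕ → Fin m))
    (hz : Tendsto (fun j => fq m (ℓ j) (z j)) atTop (𝓝 y))
    (x : ℕ → Fin m) (hx : ∀ j i, i < ℓ j → x (b j + i) = z j i) : x ∈ Gen m y := by
  show Tendsto (fun n => fq m n x) atTop (𝓝 y)
  rw [tendsto_pi_nhds] at hz ⊢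
  intro v
  let a : (ℕ → Fin m) → ℕ → ℝ := fun x i =>
    if resW m v.1 ((shift m)^[i + 1] x) = v.2 then (1 : ℝ) else 0
  have ha0 : ∀ x i, 0 ≤ a x i := fun x i => by simp only [a]; split_ifs <;> norm_num
  have ha1 : ∀ x i, a x i ≤ 1 := fun x i => by simp only [a]; split_ifs <;> norm_num
  have hfq : ∀ n x, fq m n x v = (∑ i ∈ Finset.range n, a x i) / n := by
    intro n x
    unfold fq
    rw [Finset.sum_range]
  let D : ℕ → ℝ := fun n => ∑ i ∈ Finset.range n, a x i - n * y v
  have hD : Tendsto (fun n : ℕ => D n / n) atTop (𝓝 0) := by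
    refine avg_tendsto D b hb0 hb (1 + |y v|) (by positivity) ?_ ?_ ?_
    · intro n
      have : D (n + 1) - D n = a x n - y v := by
        simp only [D, Finset.sum_range_succ]; push_cast; ring
      rw [this]
      refine (abs_sub _ _).trans ?_
      rw [abs_of_nonneg (ha0 x n)]
      linarith [ha1 x n]
    · intro ε hε
      have e1 := (Metric.tendsto_nhds.1 (hz v)) (ε / 2) (by positivity)
      obtain ⟨L, hL⟩ := exists_nat_gt (2 * v.1 / ε)
      obtain ⟨J, hJ⟩ := eventually_atTop.1 (e1.and (hℓtop.eventually_ge_atTop (L + 1)))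
      refine ⟨J, fun j hj => ?_⟩
      obtain ⟨h1, h2⟩ := hJ j hj
      rw [Real.dist_eq, hfq] at h1
      have h2' : (L : ℝ) + 1 ≤ ℓ j := by exact_mod_cast h2
      have hpos : (0 : ℝ) < ℓ j := by
        have : (0 : ℝ) ≤ L := by positivity
        linarith
      have hq : (v.1 : ℝ) ≤ ε / 2 * ℓ j := by
        rw [div_lt_iff₀ hε] at hL
        nlinarith
      have hloc : ∀ i, i + v.1 < ℓ j → a x (b j + i) = a (z j) i := by
        intro i hi
        have : resW m v.1 ((shift m)^[b j + i + 1] x) = resW m v.1 ((shift m)^[i + 1] (z j)) := by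
          funext p
          simp only [resW]
          rw [shift_iter, shift_iter, ← hx j (i + 1 + p) (by have := p.2; omega)]
          congr 1
          omega
        simp only [a, this]
      have s1 : ∑ i ∈ Finset.range (ℓ j), (a x (b j + i) - a (z j) i) ≤ v.1 := by
        refine sum_bdry _ _ _ (fun i => ?_) (fun i hi => ?_)
        · linarith [ha0 (z j) i, ha1 x (b j + i)]
        · rw [hloc i hi, sub_self]
      have s2 : ∑ i ∈ Finset.range (ℓ j), (a (z j) i - a x (b j + i)) ≤ v.1 := by
        refine sum_bdry _ _ _ (fun i => ?_) (fun i hi => ?_)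
        · linarith [ha1 (z j) i, ha0 x (b j + i)]
        · rw [hloc i hi, sub_self]
      rw [Finset.sum_sub_distrib] at s1 s2
      have hdiff : D (b (j + 1)) - D (b j) =
          ∑ i ∈ Finset.range (ℓ j), a x (b j + i) - ℓ j * y v := by
        simp only [D, hℓ, Finset.sum_range_add]; push_cast; ring
      rw [hdiff, hℓ]
      push_cast
      have h3 : |∑ i ∈ Finset.range (ℓ j), a (z j) i - ℓ j * y v| ≤ ε / 2 * ℓ j := by
        have : ∑ i ∈ Finset.range (ℓ j), a (z j) i - ℓ j * y v =
            ((∑ i ∈ Finset.range (ℓ j), a (z j) i) / ℓ j - y v) * ℓ j := by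
          field_simp
        rw [this, abs_mul, abs_of_pos hpos]
        gcongr
      rw [abs_le] at h3 ⊢
      constructor <;> linarith [h3.1, h3.2]
    · intro ε hε
      obtain ⟨J, hJ⟩ := hsmall ε hε
      refine ⟨J, fun j hj => ?_⟩
      rw [hℓ]; push_cast
      linarith [hJ j hj]
  have h := hD.add_const (y v)
  rw [zero_add] at h
  refine h.congr' ?_
  filter_upwards [eventually_ge_atTop 1] with n hn
  have hn : (0 : ℝ) < n := by exact_mod_cast hn
  rw [hfq]
  simp only [D]
  field_simp
  ring

lemma exists_words (m : ℕ) (U : Set (Wd m → ℝ)) (n : ℕ) :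
    ∃ g : Fin (cnt m U n) → (ℕ → Fin m), (∀ a, fq m n (g a) ∈ U) ∧
      ∀ a a', resW m n (g a) = resW m n (g a') → a = a' := by
  have e : (resW m n '' {x | fq m n x ∈ U}) ≃ Fin (cnt m U n) := Finite.equivFinOfCardEq rfl
  have : ∀ a, ∃ x, fq m n x ∈ U ∧ resW m n x = (e.symm a).1 := fun a => by
    obtain ⟨x, hx, h⟩ := (e.symm a).2
    exact ⟨x, hx, h⟩
  choose g hg1 hg2 using this
  refine ⟨g, hg1, fun a a' h => ?_⟩
  rw [hg2, hg2] at h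
  exact e.symm.injective (Subtype.ext h)

lemma le_htop_gen (m : ℕ) (y : Wd m → ℝ) (s : ℝ≥0)
    (hy : ∀ N ∈ 𝓝 y, ¬ SmallRate m N s) : (s : ℝ≥0∞) ≤ htop (shift m) (Gen m y) := by
  obtain ⟨N, hN⟩ := (𝓝 y).exists_antitone_basis
  have hex : ∀ k, ∃ n : ℕ, k + 1 ≤ n ∧ Real.exp (s * n) ≤ cnt m (N k) n := by
    intro k
    have h := hy (N k) (hN.1.mem_of_mem trivial)
    have h2 : ∃ᶠ n : ℕ in atTop, ¬ ((cnt m (N k) n : ℝ) ≤ 1 * Real.exp (s * n)) := by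
      intro h3
      refine h ⟨1, zero_le_one, ?_⟩
      filter_upwards [h3] with n hn
      exact not_not.1 hn
    obtain ⟨n, hn1, hn2⟩ := frequently_atTop.1 h2 (k + 1)
    exact ⟨n, hn1, by rw [one_mul] at hn2; exact (not_le.1 hn2).le⟩
  choose nn hnn1 hnn2 using hex
  let κ : ℕ → ℕ := fun j => Nat.findGreatest (fun k => nn k * k ≤ j) j
  have hκ1 : ∀ j, nn (κ j) * κ j ≤ j := fun j =>
    Nat.findGreatest_spec (P := fun k => nn k * k ≤ j) (Nat.zero_le j) (by simp)
  have hκ2 : Tendsto κ atTop atTop := by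
    rw [tendsto_atTop]
    intro k
    filter_upwards [eventually_ge_atTop k, eventually_ge_atTop (nn k * k)] with j h1 h2
    exact Nat.le_findGreatest h1 h2
  let ℓ : ℕ → ℕ := fun j => nn (κ j)
  let b : ℕ → ℕ := fun j => ∑ i ∈ Finset.range j, ℓ i
  have hℓ1 : ∀ j, κ j + 1 ≤ ℓ j := fun j => hnn1 _
  have hℓ : ∀ j, b (j + 1) = b j + ℓ j := fun j => Finset.sum_range_succ _ _
  have hb0 : b 0 = 0 := rfl
  have hb : StrictMono b := strictMono_nat_of_lt_succ fun j => by
    have := hℓ j; have := hℓ1 j; omega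
  have hbj : ∀ j, j ≤ b j := fun j => hb.le_apply
  have hℓtop : Tendsto ℓ atTop atTop :=
    tendsto_atTop_mono (fun j => (Nat.le_succ _).trans (hℓ1 j)) hκ2
  have hsmall : ∀ ε > 0, ∃ J, ∀ j ≥ J, (ℓ j : ℝ) ≤ ε * b j := by
    intro ε hε
    obtain ⟨L, hL⟩ := exists_nat_gt (1 / ε)
    obtain ⟨J, hJ⟩ := eventually_atTop.1 (hκ2.eventually_ge_atTop L)
    refine ⟨J, fun j hj => ?_⟩
    have h1 : (L : ℝ) ≤ κ j := by exact_mod_cast hJ j hj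
    have h2 : (ℓ j : ℝ) * κ j ≤ b j := by exact_mod_cast (hκ1 j).trans (hbj j)
    rw [div_lt_iff₀ hε] at hL
    have h3 : 1 ≤ κ j * ε := by nlinarith
    have h4 : (0 : ℝ) ≤ ℓ j := by positivity
    nlinarith
  choose g hg1 hg2 using fun j => exists_words m (N (κ j)) (ℓ j)
  refine le_trans ?_ (le_iSup₂_of_le (1 : ℝ) one_pos le_rfl)
  refine le_iInf₂ fun t ht => ?_
  by_contra hlt
  have hlt : (t : ℝ) < s := by
    have := not_le.1 hlt
    exact_mod_cast this
  have ht0 : (0 : ℝ) ≤ t := t.2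
  obtain ⟨J, hJ⟩ := hsmall ((s - t) / (t + 1)) (div_pos (by linarith) (by linarith))
  refine mass m (fun j => cnt m (N (κ j)) (ℓ j)) ℓ b ?_ hb0 hb hℓ g hg2 s t ?_ J ?_ (Gen m y) ?_ ht
  · intro j
    have := lt_of_lt_of_le (Real.exp_pos _) (hnn2 (κ j))
    exact_mod_cast this
  · exact fun j => hnn2 (κ j)
  · intro j hj
    have h1 := hJ j hj
    rw [hℓ]; push_cast
    have h2 : (t : ℝ) * ℓ j ≤ (s - t) * b j := by
      calc (t : ℝ) * ℓ j ≤ (t + 1) * ℓ j := by gcongr; linarith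
        _ ≤ (t + 1) * ((s - t) / (t + 1) * b j) := by gcongr
        _ = (s - t) * b j := by
          have : (t : ℝ) + 1 ≠ 0 := by linarith
          field_simp
    linarith
  · intro x ω hx
    refine concat_gen m ℓ b hb0 hb hℓ hℓtop hsmall y (fun j => g j (ω j)) ?_ x hx
    rw [hN.1.tendsto_right_iff]
    intro k _
    filter_upwards [hκ2.eventually_ge_atTop k] with j hj
    exact hN.2 hj (hg1 j (ω j))

/-- (Theorem 5.1) On the full shift `(Σ_m, σ)`, `m ≥ 2`, the spectrum
`f_{(Φ,W)} : α ↦ h_top(E_Φ(α, W))` is upper semi-continuous on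
`L_{(Φ,W)} = {α ∈ B* : E_Φ(α, W) ≠ ∅}` (for the weak* topology on `B*`). -/
theorem upperSemicontinuousOn_htop_EsetD_shift
    (m : ℕ) (hm : 2 ≤ m)
    {B : Type*} [NormedAddCommGroup B] [NormedSpace ℝ B]
    (r : ℕ) (hr : 1 ≤ r)
    (Φ : (Fin r → (ℕ → Fin m)) → WeakDual ℝ B) (hΦ : Continuous Φ) (W : Set B) :
    UpperSemicontinuousOn
      (fun α : WeakDual ℝ B => htop (shift m) (EsetD (shift m) Φ α W))
      {α : WeakDual ℝ B | (EsetD (shift m) Φ α W).Nonempty} := by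
  intro α _ c hc
  obtain ⟨s, hs1, hs2⟩ := ENNReal.lt_iff_exists_nnreal_btwn.1 hc
  let Q : Set (Wd m → ℝ) := Set.pi Set.univ (fun _ : Wd m => Set.Icc (0 : ℝ) 1)
  have hQ : IsCompact Q := isCompact_univ_pi fun _ => isCompact_Icc
  let App : B → ((Wd m → ℝ) → ℝ) → ℝ → Prop := fun w G δ => Continuous G ∧
    ∀ n, 1 ≤ n → ∀ x, |VstatD (shift m) Φ n x w - G (fq m n x)| ≤ δ
  -- either the point is a limit point for the constraint, or it is separated
  have hdich : ∀ y : Wd m → ℝ,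
      (∃ N, IsOpen N ∧ y ∈ N ∧ SmallRate m N s) ∨
      (∃ w ∈ W, ∃ G δ, App w G δ ∧ α w + δ < G y) := by
    intro y
    by_contra hcon
    rw [not_or] at hcon
    obtain ⟨h1, h2⟩ := hcon
    have hsub : Gen m y ⊆ EsetD (shift m) Φ α W := by
      intro x hx w hw
      obtain ⟨C, hC⟩ := Vstat_bdd m hm r Φ hΦ w
      refine le_of_forall_pos_le_add fun ε hε => ?_
      obtain ⟨G, hG⟩ := exists_approx m hm r Φ hΦ w (ε / 3) (by positivity)
      have h3 : G y ≤ α w + ε / 3 := by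
        by_contra h4
        exact h2 ⟨w, hw, G, ε / 3, hG, not_le.1 h4⟩
      have h5 : Tendsto (fun n => G (fq m n x)) atTop (𝓝 (G y)) :=
        (hG.1.tendsto y).comp hx
      refine limsup_le_of_le ?_ ?_
      · refine IsBoundedUnder.isCoboundedUnder_le ⟨-C, ?_⟩
        rw [eventually_map]
        filter_upwards [eventually_ge_atTop 1] with n hn
        exact (abs_le.1 (hC n hn x)).1
      · filter_upwards [eventually_ge_atTop 1,
          h5.eventually_lt_const (show G y < G y + ε / 3 by linarith)] with n hn hn2
        have := (abs_le.1 (hG.2 n hn x)).2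
        linarith
    have h3 : (s : ℝ≥0∞) ≤ htop (shift m) (Gen m y) := by
      refine le_htop_gen m y s fun N hN hsm => ?_
      obtain ⟨N', hN', ho, hy⟩ := mem_nhds_iff.1 hN
      refine h1 ⟨N', ho, hy, ?_⟩
      obtain ⟨C, hC, h⟩ := hsm
      refine ⟨C, hC, h.mono fun n hn => le_trans ?_ hn⟩
      have : cnt m N' n ≤ cnt m N n :=
        Set.ncard_le_ncard (Set.image_mono fun x hx => hN' hx) (Set.toFinite _)
      exact_mod_cast this
    have h4 : htop (shift m) (Gen m y) ≤ htop (shift m) (EsetD (shift m) Φ α W) := by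
      refine iSup₂_mono fun ε _ => ?_
      refine le_iInf₂ fun t ht => iInf₂_le t ?_
      refine le_antisymm ?_ zero_le
      rw [← ht]
      refine iSup_mono fun n => iInf_mono fun c => ?_
      exact le_iInf fun h' => iInf_le_of_le (hsub.trans h') le_rfl
    exact absurd (lt_of_le_of_lt (h3.trans h4) hs1) (lt_irrefl _)
  -- compactness
  have hcomp : ∃ U : Set (Wd m → ℝ), SmallRate m U s ∧ ∀ᶠ β : WeakDual ℝ B in 𝓝 α,
      ∀ x ∈ EsetD (shift m) Φ β W, ∀ᶠ n in atTop, fq m n x ∈ Q → fq m n x ∈ U := by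
    refine hQ.induction_on (p := fun S => ∃ U : Set (Wd m → ℝ), SmallRate m U s ∧
      ∀ᶠ β : WeakDual ℝ B in 𝓝 α,
      ∀ x ∈ EsetD (shift m) Φ β W, ∀ᶠ n in atTop, fq m n x ∈ S → fq m n x ∈ U) ?_ ?_ ?_ ?_
    · refine ⟨∅, ⟨0, le_rfl, ?_⟩, ?_⟩
      · exact Eventually.of_forall fun n => by simp [cnt]
      · exact Eventually.of_forall fun β x _ => Eventually.of_forall fun n h => h
    · rintro S T hST ⟨U, hU, h⟩
      refine ⟨U, hU, h.mono fun β hβ x hx => (hβ x hx).mono fun n hn h' => hn (hST h')⟩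
    · rintro S T ⟨U, hU, h⟩ ⟨V, hV, h'⟩
      refine ⟨U ∪ V, hU.union hV, ?_⟩
      filter_upwards [h, h'] with β h1 h2 x hx
      filter_upwards [h1 x hx, h2 x hx] with n h3 h4
      exact Or.imp h3 h4
    · intro y _
      rcases hdich y with ⟨N, hNo, hyN, hsm⟩ | ⟨w, hw, G, δ, hG, hlt⟩
      · exact ⟨N, mem_nhdsWithin_of_mem_nhds (hNo.mem_nhds hyN), N, hsm,
          Eventually.of_forall fun β x _ => Eventually.of_forall fun n h => h⟩
      · obtain ⟨e, he1, he2⟩ := exists_between hlt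
        refine ⟨{y' | e < G y'}, mem_nhdsWithin_of_mem_nhds
          ((isOpen_lt continuous_const hG.1).mem_nhds he2), ∅, ⟨0, le_rfl, ?_⟩, ?_⟩
        · exact Eventually.of_forall fun n => by simp [cnt]
        · have hev : ∀ᶠ β : WeakDual ℝ B in 𝓝 α, β w < e - δ :=
            ((WeakDual.eval_continuous w).tendsto α).eventually_lt_const (by linarith)
          filter_upwards [hev] with β hβ x hx
          obtain ⟨C, hC⟩ := Vstat_bdd m hm r Φ hΦ w
          have h6 : ∀ᶠ n in atTop, VstatD (shift m) Φ n x w < e - δ := by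
            refine eventually_lt_of_limsup_lt (lt_of_le_of_lt (hx w hw) hβ) ⟨C, ?_⟩
            rw [eventually_map]
            filter_upwards [eventually_ge_atTop 1] with n hn
            exact (abs_le.1 (hC n hn x)).2
          filter_upwards [h6, eventually_ge_atTop 1] with n h7 hn h8
          exfalso
          have h9 : e < G (fq m n x) := h8
          have := (abs_le.1 (hG.2 n hn x)).1
          linarith
  obtain ⟨U, hU, hev⟩ := hcomp
  refine mem_nhdsWithin_of_mem_nhds ?_
  filter_upwards [hev] with β hβ
  refine lt_of_le_of_lt (htop_le_of_small m hm U s hU _ fun x hx => ?_) hs2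
  exact (hβ x hx).mono fun n hn => hn (fq_mem m n x)

end Shift
end

section
/- Let (Σ_m, σ) be the full shift on m ≥ 2 symbols, r ≥ 1, k ≥ 1, and let Φ : Σ_m^r → ℝ be a function which depends only on the first k coordinates of each of its r variables. Then for every α with M_Φ(α) ≠ ∅, the supremum sup_{μ ∈ M_Φ(α)} h_μ in the variational principle h_top(E_Φ(α)) = sup_{μ ∈ M_Φ(α)} h_μ is attained by a (k−1)-step Markov measure. -/
open MeasureTheory Filter Topology
open scoped ENNReal NNReal

section Shift

/- The metric `d(x,y) = (1/2)^{min {n : x_n ≠ y_n}}` on the symbolic space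
`Σ_m = {0, …, m-1}^ℕ`; its topology is the product topology. -/
attribute [local instance] PiNat.metricSpace

/-- The cylinder set `[w] = [a_1, …, a_n]` of sequences starting with the word `w`. -/
def cyl {m : ℕ} (w : List (Fin m)) : Set (ℕ → Fin m) :=
  {x | ∀ i : ℕ, ∀ h : i < w.length, x i = w.get ⟨i, h⟩}

/-- A shift-invariant measure `μ` on `Σ_m` is an `s`-step Markov measure if the conditional
distribution of each coordinate given the past depends only on the preceding `s`
coordinates: for every word `u` of length at least `s` and every letter `a`,
`μ[ua] ⬝ μ[last s letters of u] = μ[u] ⬝ μ[(last s letters of u)a]`. -/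
def IsMarkovOfStep {m : ℕ} (s : ℕ) (μ : Measure (ℕ → Fin m)) : Prop :=
  MeasurePreserving (shift m) μ μ ∧
  ∀ (u : List (Fin m)) (a : Fin m), s ≤ u.length →
    μ (cyl (u ++ [a])) * μ (cyl (u.drop (u.length - s))) =
      μ (cyl u) * μ (cyl (u.drop (u.length - s) ++ [a]))

/-! ### Finite entropy inequalities -/

namespace MarkovMax

open Real in
lemma core_submod {α β : Type*} [Fintype α] [Fintype β] (M : α → β → ℝ) (hM : ∀ a b, 0 ≤ M a b)
    (R : α → ℝ) (C : β → ℝ) (T : ℝ) (hR : ∀ a, ∑ b, M a b = R a) (hC : ∀ b, ∑ a, M a b = C b)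
    (hT : ∑ a, R a = T) :
    ∑ a, ∑ b, negMulLog (M a b) + negMulLog T ≤ ∑ a, negMulLog (R a) + ∑ b, negMulLog (C b) := by
  have hR0 : ∀ a, 0 ≤ R a := fun a => hR a ▸ Finset.sum_nonneg fun b _ => hM a b
  have hC0 : ∀ b, 0 ≤ C b := fun b => hC b ▸ Finset.sum_nonneg fun a _ => hM a b
  have hT0 : 0 ≤ T := hT ▸ Finset.sum_nonneg fun a _ => hR0 a
  have hTC : ∑ b, C b = T := by
    rw [← hT]; simp_rw [← hR, ← hC]; exact Finset.sum_comm
  have key : ∀ a b, negMulLog (M a b) ≤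
      -(M a b * log (R a)) - M a b * log (C b) + M a b * log T + (R a * C b / T - M a b) := by
    intro a b
    rcases (hM a b).eq_or_lt with h | h
    · rw [← h]; simp; have := hR0 a; have := hC0 b; positivity
    · have h1 : M a b ≤ R a := hR a ▸ Finset.single_le_sum (fun b _ => hM a b) (Finset.mem_univ b)
      have h2 : M a b ≤ C b := hC b ▸ Finset.single_le_sum (fun a _ => hM a b) (Finset.mem_univ a)
      have h3 : R a ≤ T := hT ▸ Finset.single_le_sum (fun a _ => hR0 a) (Finset.mem_univ a)
      have r0 : 0 < R a := by linarith
      have c0 : 0 < C b := by linarith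
      have t0 : 0 < T := by linarith
      have hl := log_le_sub_one_of_pos (show 0 < R a * C b / T / M a b by positivity)
      rw [log_div (by positivity) h.ne', log_div (by positivity) t0.ne',
        log_mul r0.ne' c0.ne'] at hl
      have := mul_le_mul_of_nonneg_left hl h.le
      have e : M a b * (R a * C b / T / M a b - 1) = R a * C b / T - M a b := by
        field_simp
      rw [e] at this
      rw [negMulLog]
      linarith
  have h1 : ∑ a, ∑ b, negMulLog (M a b) ≤ ∑ a, ∑ b,
      (-(M a b * log (R a)) - M a b * log (C b) + M a b * log T + (R a * C b / T - M a b)) :=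
    Finset.sum_le_sum fun a _ => Finset.sum_le_sum fun b _ => key a b
  simp only [Finset.sum_add_distrib, Finset.sum_sub_distrib, Finset.sum_neg_distrib] at h1
  have e1 : ∑ a, ∑ b, M a b * log (R a) = - ∑ a, negMulLog (R a) := by
    rw [← Finset.sum_neg_distrib]
    refine Finset.sum_congr rfl fun a _ => ?_
    rw [← Finset.sum_mul, hR, negMulLog]; ring
  have e2 : ∑ a, ∑ b, M a b * log (C b) = - ∑ b, negMulLog (C b) := by
    rw [Finset.sum_comm, ← Finset.sum_neg_distrib]
    refine Finset.sum_congr rfl fun a _ => ?_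
    rw [← Finset.sum_mul, hC, negMulLog]; ring
  have e3 : ∑ a, ∑ b, M a b * log T = - negMulLog T := by
    simp_rw [← Finset.sum_mul, hR, hT, negMulLog]; ring
  have e4 : ∑ a, ∑ b, R a * C b / T = T := by
    simp_rw [← Finset.sum_div, ← Finset.mul_sum, hTC, ← Finset.sum_mul, hT]
    by_cases h : T = 0
    · simp [h]
    · field_simp
  have e5 : ∑ a, ∑ b, M a b = T := by simp_rw [hR, hT]
  rw [e1, e2, e3, e4, e5] at h1
  linarith

open Real in
lemma core_mono {α : Type*} [Fintype α] (M : α → ℝ) (hM : ∀ a, 0 ≤ M a) :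
    negMulLog (∑ a, M a) ≤ ∑ a, negMulLog (M a) := by
  rw [negMulLog, neg_mul, Finset.sum_mul, ← Finset.sum_neg_distrib]
  refine Finset.sum_le_sum fun a _ => ?_
  rcases (hM a).eq_or_lt with h | h
  · rw [← h]; simp
  · rw [negMulLog]
    have : log (M a) ≤ log (∑ a, M a) :=
      log_le_log h (Finset.single_le_sum (fun b _ => hM b) (Finset.mem_univ a))
    nlinarith

/-- Entropy of a finite-valued map. -/
noncomputable def ent {Ω : Type*} [MeasurableSpace Ω] {ι : Type*} [Fintype ι]
    (μ : Measure Ω) (P : Ω → ι) : ℝ :=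
  ∑ i : ι, Real.negMulLog ((μ (P ⁻¹' {i})).toReal)

section ent
set_option linter.unusedSectionVars false
variable {Ω : Type*} [MeasurableSpace Ω] {μ : Measure Ω} [IsProbabilityMeasure μ]
variable {α β γ : Type*} [Fintype α] [Fintype β] [Fintype γ]
  [MeasurableSpace α] [MeasurableSpace β] [MeasurableSpace γ]
  [MeasurableSingletonClass α] [MeasurableSingletonClass β] [MeasurableSingletonClass γ]

lemma sum_fiber (X : Ω → α) (hX : Measurable X) (S : Set Ω) :
    ∑ a, (μ (X ⁻¹' {a} ∩ S)).toReal = (μ S).toReal := by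
  classical
  rw [← ENNReal.toReal_sum (fun _ _ => measure_ne_top _ _)]
  congr 1
  have := sum_measure_preimage_singleton (μ := μ.restrict S) (f := X) Finset.univ
    (fun y _ => hX (measurableSet_singleton y))
  simp only [Finset.coe_univ, Set.preimage_univ, Measure.restrict_apply_univ] at this
  rw [← this]
  exact Finset.sum_congr rfl fun a _ => (Measure.restrict_apply (hX (measurableSet_singleton a))).symm

lemma pre_prod (X : Ω → α) (Y : Ω → β) (a : α) (b : β) :
    (fun ω => (X ω, Y ω)) ⁻¹' {(a, b)} = X ⁻¹' {a} ∩ Y ⁻¹' {b} := by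
  ext; simp

lemma ent_submod (X : Ω → α) (Y : Ω → β) (Z : Ω → γ) (hX : Measurable X) (hY : Measurable Y) :
    ent μ (fun ω => (X ω, Y ω, Z ω)) + ent μ Z ≤
      ent μ (fun ω => (X ω, Z ω)) + ent μ (fun ω => (Y ω, Z ω)) := by
  have h := Finset.sum_le_sum fun (c : γ) (_ : c ∈ Finset.univ) =>
    core_submod (fun a b => (μ (X ⁻¹' {a} ∩ (Y ⁻¹' {b} ∩ Z ⁻¹' {c}))).toReal)
    (fun _ _ => ENNReal.toReal_nonneg) (fun a => (μ (X ⁻¹' {a} ∩ Z ⁻¹' {c})).toReal)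
    (fun b => (μ (Y ⁻¹' {b} ∩ Z ⁻¹' {c})).toReal) (μ (Z ⁻¹' {c})).toReal
    (fun a => by
      rw [← sum_fiber Y hY]
      refine Finset.sum_congr rfl fun b _ => ?_
      congr 2; ext; simp; tauto)
    (fun b => sum_fiber X hX _) (sum_fiber X hX _)
  simp only [Finset.sum_add_distrib] at h
  unfold ent
  simp only [Fintype.sum_prod_type, pre_prod]
  have e1 : ∀ f : α → β → γ → ℝ, ∑ a, ∑ b, ∑ c, f a b c = ∑ c, ∑ a, ∑ b, f a b c := by
    intro f
    rw [Finset.sum_comm' (t' := Finset.univ) (s' := fun _ => Finset.univ) (by simp)]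
    conv_rhs => rw [Finset.sum_comm]
    rw [Finset.sum_comm]
    refine Finset.sum_congr rfl fun a _ => ?_
    rw [Finset.sum_comm]
  rw [e1, Finset.sum_comm (s := Finset.univ (α := α)) (t := Finset.univ (α := γ)),
    Finset.sum_comm (s := Finset.univ (α := β)) (t := Finset.univ (α := γ))]
  exact h

lemma ent_le_pair (X : Ω → α) (Z : Ω → γ) (hX : Measurable X) :
    ent μ Z ≤ ent μ (fun ω => (X ω, Z ω)) := by
  unfold ent
  simp only [Fintype.sum_prod_type, pre_prod]
  rw [Finset.sum_comm]
  refine Finset.sum_le_sum fun c _ => ?_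
  rw [← sum_fiber X hX]
  exact core_mono _ fun _ => ENNReal.toReal_nonneg

lemma ent_inj (X : Ω → α) (e : α → β) (he : Function.Injective e) :
    ent μ (fun ω => e (X ω)) = ent μ X := by
  classical
  unfold ent
  rw [← Finset.sum_subset (Finset.subset_univ (Finset.univ.image e))]
  · rw [Finset.sum_image fun a _ b _ h => he h]
    refine Finset.sum_congr rfl fun a _ => ?_
    congr 3; ext ω; simp [he.eq_iff]
  · intro b _ hb
    have : (fun ω => e (X ω)) ⁻¹' {b} = ∅ := by
      ext ω; simp at hb ⊢; exact hb _
    simp [this]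

lemma ent_cond (X : Ω → α) (Z : Ω → γ) (f : γ → β) (hX : Measurable X) (hZ : Measurable Z) :
    ent μ (fun ω => (X ω, Z ω)) - ent μ Z ≤
      ent μ (fun ω => (X ω, f (Z ω))) - ent μ (fun ω => f (Z ω)) := by
  have h := ent_submod (μ := μ) X Z (fun ω => f (Z ω)) hX hZ
  have e1 := ent_inj (μ := μ) (fun ω => (X ω, Z ω)) (fun p => (p.1, p.2, f p.2))
    (by rintro ⟨a, b⟩ ⟨c, d⟩; simp; tauto)
  have e2 := ent_inj (μ := μ) Z (fun p => (p, f p)) (by intro a b; simp; tauto)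
  simp only at e1 e2
  linarith

lemma ent_chain (n : ℕ) (X : Fin n → Ω → α) (Z : Ω → γ) (hX : ∀ i, Measurable (X i)) :
    ent μ (fun ω => ((fun i => X i ω), Z ω)) ≤
      ent μ Z + ∑ i, (ent μ (fun ω => (X i ω, Z ω)) - ent μ Z) := by
  induction n with
  | zero =>
    simp
    exact (ent_inj (μ := μ) Z (fun z => ((fun i => Fin.elim0 i : Fin 0 → α), z))
      (by intro a b; simp)).symm.ge.trans' (le_of_eq (by congr; ext ω i; exact Fin.elim0 i; rfl))
  | succ n ih =>
    have h := ent_submod (μ := μ) (X 0) (fun ω => fun i : Fin n => X i.succ ω) Z (hX 0)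
      (measurable_pi_lambda _ fun i => hX _)
    have ih := ih (fun i => X i.succ) fun i => hX _
    have e := ent_inj (μ := μ) (fun ω => (X 0 ω, (fun i : Fin n => X i.succ ω), Z ω))
      (fun p => ((Fin.cons p.1 p.2.1 : Fin (n+1) → α), p.2.2))
      (by rintro ⟨a, b, c⟩ ⟨a', b', c'⟩; simp [Fin.cons_inj]; tauto)
    have e' : (fun ω => ((Fin.cons (X 0 ω) (fun i : Fin n => X i.succ ω) : Fin (n+1) → α), Z ω))
       = fun ω => ((fun i => X i ω), Z ω) := by
      ext ω i
      · refine Fin.cases ?_ (fun i => ?_) i <;> simp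
      · rfl
    simp only [e'] at e
    rw [Fin.sum_univ_succ, e]
    linarith

end ent
end MarkovMax

namespace MarkovMax

/-! ### Invariant weights on words -/

variable {m : ℕ}

/-- Sum over words of length `n`. -/
def wsum (n : ℕ) (f : List (Fin m) → ℝ) : ℝ := ∑ x : Fin n → Fin m, f (List.ofFn x)

lemma wsum_congr {n : ℕ} {f g : List (Fin m) → ℝ} (h : ∀ u, u.length = n → f u = g u) :
    wsum n f = wsum n g := Finset.sum_congr rfl fun x _ => h _ (by simp)

lemma wsum_le {n : ℕ} {f g : List (Fin m) → ℝ} (h : ∀ u, u.length = n → f u ≤ g u) :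
    wsum n f ≤ wsum n g := Finset.sum_le_sum fun x _ => h _ (by simp)

lemma wsum_add {n : ℕ} (f g : List (Fin m) → ℝ) :
    wsum n (fun u => f u + g u) = wsum n f + wsum n g := Finset.sum_add_distrib

lemma wsum_cons (n : ℕ) (f : List (Fin m) → ℝ) :
    wsum (n + 1) f = wsum n (fun u => ∑ a, f (a :: u)) := by
  unfold wsum
  rw [← (Fin.consEquiv (fun _ : Fin (n+1) => Fin m)).sum_comp, Fintype.sum_prod_type,
    Finset.sum_comm]
  simp [Fin.consEquiv]

lemma ofFn_snoc {n : ℕ} (x : Fin n → Fin m) (a : Fin m) :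
    List.ofFn (Fin.snoc x a : Fin (n+1) → Fin m) = List.ofFn x ++ [a] := by
  rw [List.ofFn_succ']
  simp

lemma wsum_snoc (n : ℕ) (f : List (Fin m) → ℝ) :
    wsum (n + 1) f = wsum n (fun u => ∑ a, f (u ++ [a])) := by
  unfold wsum
  rw [← (Fin.snocEquiv (fun _ : Fin (n+1) => Fin m)).sum_comp, Fintype.sum_prod_type,
    Finset.sum_comm]
  refine Finset.sum_congr rfl fun x _ => Finset.sum_congr rfl fun a _ => ?_
  exact congrArg f (ofFn_snoc x a)

/-- Cylinder weights of invariant probability measures. -/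
structure IsW (W : List (Fin m) → ℝ) : Prop where
  nonneg : ∀ u, 0 ≤ W u
  nil : W [] = 1
  snoc : ∀ u, ∑ a, W (u ++ [a]) = W u
  cons : ∀ u, ∑ a, W (a :: u) = W u

/-- Entropy of words of length `n`. -/
noncomputable def HW (W : List (Fin m) → ℝ) (n : ℕ) : ℝ := wsum n (fun u => Real.negMulLog (W u))

lemma IsW.cons_le {W : List (Fin m) → ℝ} (h : IsW W) (a : Fin m) (u) : W (a :: u) ≤ W u :=
  h.cons u ▸ Finset.single_le_sum (f := fun a => W (a :: u)) (fun _ _ => h.nonneg _)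
    (Finset.mem_univ a)

lemma IsW.snoc_le {W : List (Fin m) → ℝ} (h : IsW W) (a : Fin m) (u) : W (u ++ [a]) ≤ W u :=
  h.snoc u ▸ Finset.single_le_sum (f := fun a => W (u ++ [a])) (fun _ _ => h.nonneg _)
    (Finset.mem_univ a)

lemma IsW.le_one {W : List (Fin m) → ℝ} (h : IsW W) (u) : W u ≤ 1 := by
  induction u with
  | nil => exact h.nil.le
  | cons a u ih => exact (h.cons_le a u).trans ih

lemma HW_zero {W : List (Fin m) → ℝ} (h : IsW W) : HW W 0 = 0 := by
  simp [HW, wsum, h.nil]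

lemma IsW.concave {W : List (Fin m) → ℝ} (h : IsW W) (n : ℕ) :
    HW W (n + 2) - HW W (n + 1) ≤ HW W (n + 1) - HW W n := by
  have key : wsum n (fun u => ∑ a, ∑ b, Real.negMulLog (W (a :: (u ++ [b])))) + HW W n ≤
      wsum n (fun u => ∑ a, Real.negMulLog (W (a :: u))) +
      wsum n (fun u => ∑ b, Real.negMulLog (W (u ++ [b]))) := by
    rw [HW, ← wsum_add, ← wsum_add]
    refine wsum_le fun u _ => ?_
    exact core_submod (fun a b => W (a :: (u ++ [b]))) (fun _ _ => h.nonneg _)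
      (fun a => W (a :: u)) (fun b => W (u ++ [b])) (W u) (fun a => h.snoc (a :: u))
      (fun b => h.cons _) (h.cons u)
  have e1 : HW W (n + 2) = wsum n (fun u => ∑ a, ∑ b, Real.negMulLog (W (a :: (u ++ [b])))) := by
    rw [HW, wsum_snoc, wsum_cons]
    refine wsum_congr fun u _ => ?_
    simp
  rw [← e1, ← wsum_cons n (fun u => Real.negMulLog (W u)),
    ← wsum_snoc n (fun u => Real.negMulLog (W u))] at key
  simp only [HW] at key ⊢
  linarith

lemma IsW.antitone {W : List (Fin m) → ℝ} (h : IsW W) :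
    Antitone fun n => HW W (n + 1) - HW W n :=
  antitone_nat_of_succ_le fun n => h.concave n

lemma IsW.HW_le {W : List (Fin m) → ℝ} (h : IsW W) (s n : ℕ) :
    HW W (s + n) ≤ HW W s + n * (HW W (s + 1) - HW W s) := by
  induction n with
  | zero => simp
  | succ n ih =>
    have := h.antitone (show s ≤ s + n by omega)
    simp only at this
    push_cast
    rw [← add_assoc]
    linarith

/-- The `s`-step Markov approximation of a weight. -/
noncomputable def mk (s : ℕ) (W : List (Fin m) → ℝ) : List (Fin m) → ℝ
  | [] => 1
  | a :: u => if u.length < s then W (a :: u) else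
      mk s W u * (W ((a :: u).take (s + 1)) / W (u.take s))

section
set_option linter.unusedSectionVars false
variable {W : List (Fin m) → ℝ} 

lemma mk_short (h : IsW W) (s : ℕ) (u : List (Fin m)) (hu : u.length ≤ s + 1) : mk s W u = W u := by
  induction u with
  | nil => simp [mk, h.nil]
  | cons a u ih =>
    rw [mk]
    split_ifs with hl
    · rfl
    · simp only [List.length_cons] at hu
      have : u.length = s := by omega
      rw [ih (by omega), List.take_of_length_le (by simp; omega), List.take_of_length_le (by omega)]
      by_cases h0 : W u = 0
      · have := h.cons_le a u
        have := h.nonneg (a :: u)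
        rw [h0]; simp; linarith
      · field_simp

lemma mk_long (h : IsW W) (s : ℕ) (a : Fin m) (u : List (Fin m)) (hu : s ≤ u.length) :
    mk s W (a :: u) = mk s W u * (W (a :: u.take s) / W (u.take s)) := by
  rw [mk, if_neg (by omega)]; rfl

lemma mk_nonneg (h : IsW W) (s : ℕ) (u : List (Fin m)) : 0 ≤ mk s W u := by
  induction u with
  | nil => simp [mk]
  | cons a u ih =>
    rw [mk]
    split_ifs
    · exact h.nonneg _
    · exact mul_nonneg ih (div_nonneg (h.nonneg _) (h.nonneg _))

lemma mk_snoc (h : IsW W) (s : ℕ) (u : List (Fin m)) : ∑ b, mk s W (u ++ [b]) = mk s W u := by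
  induction u with
  | nil =>
    rw [mk_short h s [] (by simp), ← h.snoc []]
    exact Finset.sum_congr rfl fun b _ => mk_short h s _ (by simp)
  | cons a u ih =>
    by_cases hl : s ≤ u.length
    · rw [mk_long h s a u hl, ← ih, Finset.sum_mul]
      refine Finset.sum_congr rfl fun b _ => ?_
      rw [List.cons_append, mk_long h s _ _ (by simp; omega), List.take_append_of_le_length hl]
    · rw [mk_short h s _ (by simp; omega), ← h.snoc]
      exact Finset.sum_congr rfl fun b _ => mk_short h s _ (by simp; omega)

lemma mk_zero (h : IsW W) (s : ℕ) (u : List (Fin m)) (h0 : W (u.take s) = 0) : mk s W u = 0 := by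
  induction u using List.reverseRecOn with
  | nil => simp [h.nil] at h0
  | append_singleton u b ih =>
    by_cases hl : s ≤ u.length
    · rw [List.take_append_of_le_length hl] at h0
      have e := mk_snoc h s u
      rw [ih h0, Finset.sum_eq_zero_iff_of_nonneg (fun _ _ => mk_nonneg h s _)] at e
      exact e b (Finset.mem_univ _)
    · rw [List.take_of_length_le (by simp; omega)] at h0
      rw [mk_short h s _ (by simp; omega), h0]

lemma ratio_sum (h : IsW W) (v : List (Fin m)) (hv : W v ≠ 0) : ∑ a, W (a :: v) / W v = 1 := by
  rw [← Finset.sum_div, h.cons, div_self hv]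

lemma mk_cons (h : IsW W) (s : ℕ) (u : List (Fin m)) : ∑ a, mk s W (a :: u) = mk s W u := by
  by_cases hl : s ≤ u.length
  · simp_rw [mk_long h s _ u hl]
    by_cases h0 : W (u.take s) = 0
    · simp [mk_zero h s u h0]
    · rw [← Finset.mul_sum, ratio_sum h _ h0, mul_one]
  · rw [mk_short h s _ (by omega), ← h.cons]
    exact Finset.sum_congr rfl fun b _ => mk_short h s _ (by simp; omega)

lemma mk_isW (h : IsW W) (s : ℕ) : IsW (mk s W) :=
  ⟨mk_nonneg h s, by simp [mk], mk_snoc h s, mk_cons h s⟩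

lemma mk_markov (h : IsW W) (s : ℕ) (u : List (Fin m)) (b : Fin m) (hu : s ≤ u.length) :
    mk s W (u ++ [b]) * mk s W (u.drop (u.length - s)) =
      mk s W u * mk s W (u.drop (u.length - s) ++ [b]) := by
  induction u with
  | nil => simp [mul_comm]
  | cons a u ih =>
    by_cases hl : s ≤ u.length
    · have e : (a :: u).length - s = (u.length - s) + 1 := by simp; omega
      rw [e, List.drop_succ_cons, List.cons_append, mk_long h s _ _ hl,
        mk_long h s _ _ (by simp; omega), List.take_append_of_le_length hl]
      have := ih hl
      linear_combination (W (a :: u.take s) / W (u.take s)) * this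
    · have e : (a :: u).length - s = 0 := by simp at hu ⊢; omega
      rw [e, List.drop_zero, mul_comm]

lemma wsum_take (h : IsW W) (s : ℕ) (g : List (Fin m) → ℝ) (n : ℕ) :
    wsum (s + n) (fun u => mk s W u * g (u.take s)) = wsum s (fun u => mk s W u * g (u.take s)) := by
  induction n with
  | zero => rfl
  | succ n ih =>
    rw [← ih, ← add_assoc, wsum_snoc]
    refine wsum_congr fun u hu => ?_
    rw [← mk_snoc h s u, Finset.sum_mul]
    refine Finset.sum_congr rfl fun b _ => ?_
    rw [List.take_append_of_le_length (by omega)]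

lemma HW_mk_step (h : IsW W) (s : ℕ) (n : ℕ) : HW (mk s W) (s + n + 1) - HW (mk s W) (s + n) =
    wsum s (fun u => mk s W u * ∑ a, Real.negMulLog (W (a :: u.take s) / W (u.take s))) := by
  rw [← wsum_take h s (fun v => ∑ a, Real.negMulLog (W (a :: v) / W v)) n, sub_eq_iff_eq_add', HW,
    HW, wsum_cons, ← wsum_add]
  refine wsum_congr fun u hu => ?_
  simp_rw [mk_long h s _ u (by omega), Real.negMulLog_mul]
  rw [Finset.sum_add_distrib, ← Finset.sum_mul, ← Finset.mul_sum]
  by_cases h0 : W (u.take s) = 0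
  · simp [mk_zero h s u h0]
  · rw [ratio_sum h _ h0, one_mul]

lemma HW_mk_short (h : IsW W) (s : ℕ) (n : ℕ) (hn : n ≤ s + 1) : HW (mk s W) n = HW W n :=
  wsum_congr fun u hu => by rw [mk_short h s u (by omega)]

lemma HW_mk_ge (h : IsW W) (s : ℕ) (n : ℕ) : n * (HW W (s + 1) - HW W s) ≤ HW (mk s W) n := by
  have hd : ∀ n, HW W (s + 1) - HW W s ≤ HW (mk s W) (n + 1) - HW (mk s W) n := by
    intro n
    have h1 := (mk_isW h s).antitone (show n ≤ s + n by omega)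
    simp only at h1
    have h2 := HW_mk_step h s 0
    rw [← HW_mk_step h s n] at h2
    rw [← HW_mk_short h s (s + 1) le_rfl, ← HW_mk_short h s s (by omega)]
    simp only [add_zero] at h2
    linarith
  induction n with
  | zero => simp [HW_zero (mk_isW h s)]
  | succ n ih =>
    have := hd n
    push_cast
    linarith

end

/-- Existence of a maximiser of the conditional entropy among invariant weights with a closed
constraint. -/
lemma exists_max (s : ℕ) (G : (List (Fin m) → ℝ) → ℝ) (hG : Continuous G) (α : ℝ)
    (hne : ∃ W, IsW W ∧ G W = α) :
    ∃ W, IsW W ∧ G W = α ∧ ∀ W', IsW W' → G W' = α →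
      HW W' (s + 1) - HW W' s ≤ HW W (s + 1) - HW W s := by
  have hHc : ∀ n, Continuous fun W : List (Fin m) → ℝ => HW W n := fun n =>
    continuous_finsetSum _ fun x _ => Real.continuous_negMulLog.comp (continuous_apply _)
  have hcomp : IsCompact {W : List (Fin m) → ℝ | IsW W ∧ G W = α} := by
    refine (isCompact_univ_pi (fun _ : List (Fin m) => isCompact_Icc (a := (0:ℝ)) (b := 1))).of_isClosed_subset
      ?_ (fun W hW u _ => ⟨hW.1.nonneg u, hW.1.le_one u⟩)
    have : {W : List (Fin m) → ℝ | IsW W ∧ G W = α} =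
        {W | ∀ u, 0 ≤ W u} ∩ ({W | W [] = 1} ∩ ({W | ∀ u, ∑ a, W (u ++ [a]) = W u} ∩
          ({W | ∀ u, ∑ a, W (a :: u) = W u} ∩ {W | G W = α}))) := by
      ext W
      constructor
      · rintro ⟨⟨a, b, c, d⟩, e⟩; exact ⟨a, b, c, d, e⟩
      · rintro ⟨a, b, c, d, e⟩; exact ⟨⟨a, b, c, d⟩, e⟩
    rw [this]
    simp only [Set.ofPred_forall]
    refine IsClosed.inter (isClosed_iInter fun u => isClosed_le continuous_const (continuous_apply _))
      (IsClosed.inter (isClosed_eq (continuous_apply _) continuous_const)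
      (IsClosed.inter (isClosed_iInter fun u => isClosed_eq (by fun_prop) (continuous_apply _))
      (IsClosed.inter (isClosed_iInter fun u => isClosed_eq (by fun_prop) (continuous_apply _))
      (isClosed_eq hG continuous_const))))
  obtain ⟨W0, h0⟩ := hne
  obtain ⟨W, hW, hmax⟩ := hcomp.exists_isMaxOn ⟨W0, h0⟩ ((hHc (s+1)).sub (hHc s)).continuousOn
  exact ⟨W, hW.1, hW.2, fun W' h1 h2 => hmax ⟨h1, h2⟩⟩

end MarkovMax

namespace MarkovMax

/-! ### Cylinders and measures -/

section meas
variable {m : ℕ}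

/-- The first `n` letters. -/
def pref (n : ℕ) (x : ℕ → Fin m) : Fin n → Fin m := fun i => x i

lemma measurable_pref (n : ℕ) : Measurable (pref n : (ℕ → Fin m) → _) :=
  measurable_pi_lambda _ fun _ => measurable_pi_apply _

lemma measurable_shift : Measurable (shift m) :=
  measurable_pi_lambda _ fun _ => measurable_pi_apply _

lemma shift_iter (j : ℕ) (x : ℕ → Fin m) (n : ℕ) : (shift m)^[j] x n = x (n + j) := by
  induction j generalizing x with
  | zero => rfl
  | succ j ih => rw [Function.iterate_succ_apply, ih]; rfl

lemma cyl_ofFn {n : ℕ} (w : Fin n → Fin m) : cyl (List.ofFn w) = pref n ⁻¹' {w} := by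
  ext x
  simp only [cyl, Set.mem_ofPred_eq, Set.mem_preimage, Set.mem_singleton_iff, funext_iff, pref]
  constructor
  · intro h i; simpa using h i (by simp)
  · intro h i hi
    simp at hi
    simpa using h ⟨i, hi⟩

lemma measurableSet_cyl (u : List (Fin m)) : MeasurableSet (cyl u) := by
  rw [← List.ofFn_get u, cyl_ofFn]
  exact measurable_pref _ (measurableSet_singleton _)

lemma cyl_snoc (u : List (Fin m)) (a : Fin m) :
    cyl (u ++ [a]) = (fun x : ℕ → Fin m => x u.length) ⁻¹' {a} ∩ cyl u := by
  ext x
  simp only [cyl, Set.mem_ofPred_eq, Set.mem_inter_iff, Set.mem_preimage, Set.mem_singleton_iff,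
    List.get_eq_getElem, List.length_append, List.length_cons, List.length_nil]
  constructor
  · intro h
    refine ⟨by simpa using h u.length (by simp), fun i hi => ?_⟩
    rw [h i (by omega), List.getElem_append_left hi]
  · rintro ⟨h1, h2⟩ i hi
    by_cases hl : i < u.length
    · rw [List.getElem_append_left hl]; exact h2 i hl
    · have : i = u.length := by omega
      subst this
      simpa using h1

lemma cyl_cons (u : List (Fin m)) (a : Fin m) :
    cyl (a :: u) = (fun x : ℕ → Fin m => x 0) ⁻¹' {a} ∩ shift m ⁻¹' cyl u := by
  ext x
  simp only [cyl, Set.mem_ofPred_eq, Set.mem_inter_iff, Set.mem_preimage, Set.mem_singleton_iff,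
    List.get_eq_getElem, List.length_cons, shift]
  constructor
  · intro h
    refine ⟨by simpa using h 0 (by simp), fun i hi => by simpa using h (i+1) (by omega)⟩
  · rintro ⟨h1, h2⟩ i hi
    cases i with
    | zero => simpa using h1
    | succ i => simpa using h2 i (by omega)

/-- The algebra of sets depending on finitely many letters. -/
def cylAlg (m : ℕ) : Set (Set (ℕ → Fin m)) := {A | ∃ n, ∃ S : Set (Fin n → Fin m), A = pref n ⁻¹' S}

lemma cyl_lift {n N : ℕ} (h : n ≤ N) (S : Set (Fin n → Fin m)) :
    ∃ S' : Set (Fin N → Fin m), (pref n ⁻¹' S : Set (ℕ → Fin m)) = pref N ⁻¹' S' :=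
  ⟨{w | (fun i : Fin n => w (Fin.castLE h i)) ∈ S}, rfl⟩

lemma cylAlg_isSetAlgebra : IsSetAlgebra (cylAlg m) where
  empty_mem := ⟨0, ∅, by simp⟩
  compl_mem := by
    rintro _ ⟨n, S, rfl⟩
    exact ⟨n, Sᶜ, rfl⟩
  union_mem := by
    rintro _ _ ⟨n, S, rfl⟩ ⟨n', S', rfl⟩
    obtain ⟨A, hA⟩ := cyl_lift (le_max_left n n') S
    obtain ⟨B, hB⟩ := cyl_lift (le_max_right n n') S'
    exact ⟨max n n', A ∪ B, by rw [hA, hB]; rfl⟩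

lemma cylAlg_gen : (MeasurableSpace.pi : MeasurableSpace (ℕ → Fin m)) =
    MeasurableSpace.generateFrom (cylAlg m) := by
  apply le_antisymm
  · refine iSup_le fun i => ?_
    rintro _ ⟨S, -, rfl⟩
    refine MeasurableSpace.measurableSet_generateFrom ⟨i + 1, {w | w (Fin.last i) ∈ S}, ?_⟩
    ext x; simp [pref]
  · refine MeasurableSpace.generateFrom_le ?_
    rintro _ ⟨n, S, rfl⟩
    exact measurable_pref n S.toFinite.measurableSet

lemma ext_cyl (μ ν : Measure (ℕ → Fin m)) [IsProbabilityMeasure μ] [IsProbabilityMeasure ν]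
    (h : ∀ u, μ (cyl u) = ν (cyl u)) : μ = ν := by
  classical
  refine ext_of_generate_finite (cylAlg m) cylAlg_gen ?_ ?_ (by simp)
  · intro s hs t ht _
    exact cylAlg_isSetAlgebra.inter_mem hs ht
  · rintro _ ⟨n, S, rfl⟩
    have e : ∀ ρ : Measure (ℕ → Fin m), ρ (pref n ⁻¹' S) =
        ∑ w ∈ S.toFinite.toFinset, ρ (pref n ⁻¹' {w}) := by
      intro ρ
      rw [sum_measure_preimage_singleton _ (fun y _ => measurable_pref n (measurableSet_singleton y))]
      simp
    rw [e, e]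
    refine Finset.sum_congr rfl fun w _ => ?_
    rw [← cyl_ofFn, h]

/-- The weights of a measure. -/
noncomputable def Wm (μ : Measure (ℕ → Fin m)) (u : List (Fin m)) : ℝ := (μ (cyl u)).toReal

lemma sum_cons_cyl (μ : Measure (ℕ → Fin m)) [IsProbabilityMeasure μ] (u : List (Fin m)) :
    ∑ a, (μ (cyl (a :: u))).toReal = (μ (shift m ⁻¹' cyl u)).toReal := by
  simp_rw [cyl_cons]
  exact sum_fiber (fun x : ℕ → Fin m => x 0) (measurable_pi_apply 0) _

lemma Wm_isW (μ : Measure (ℕ → Fin m)) [IsProbabilityMeasure μ]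
    (h : MeasurePreserving (shift m) μ μ) : IsW (Wm μ) where
  nonneg _ := ENNReal.toReal_nonneg
  nil := by
    have : cyl ([] : List (Fin m)) = Set.univ := by ext; simp [cyl]
    simp [Wm, this]
  snoc u := by
    simp_rw [Wm, cyl_snoc]
    exact sum_fiber (fun x : ℕ → Fin m => x u.length) (measurable_pi_apply _) _
  cons u := by
    unfold Wm
    rw [sum_cons_cyl, h.measure_preimage (measurableSet_cyl u).nullMeasurableSet]

lemma HW_Wm (μ : Measure (ℕ → Fin m)) (n : ℕ) : HW (Wm μ) n = ent μ (pref n) := by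
  unfold HW ent wsum Wm
  simp_rw [cyl_ofFn]

/-- Prefixes of the sequence driven by `ξ`. -/
def pre (ξ : List (Fin m) → Fin m) : ℕ → List (Fin m)
  | 0 => []
  | n + 1 => pre ξ n ++ [ξ (pre ξ n)]

/-- Sequence driven by `ξ`. -/
def drive (ξ : List (Fin m) → Fin m) : ℕ → Fin m := fun n => ξ (pre ξ n)

lemma measurable_drive : Measurable (drive : (List (Fin m) → Fin m) → (ℕ → Fin m)) := by
  let _ : MeasurableSpace (List (Fin m)) := ⊤
  have hev : Measurable (fun p : (List (Fin m) → Fin m) × List (Fin m) => p.1 p.2) :=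
    measurable_from_prod_countable_left fun y => measurable_pi_apply y
  have hpre : ∀ n, Measurable (fun ξ : List (Fin m) → Fin m => pre ξ n) := by
    intro n
    induction n with
    | zero => exact measurable_const
    | succ n ih =>
      have h1 : Measurable (fun p : Fin m × List (Fin m) => p.2 ++ [p.1]) :=
        measurable_from_prod_countable_left fun y => measurable_of_countable _
      exact h1.comp ((hev.comp (measurable_id.prodMk ih)).prodMk ih)
  exact measurable_pi_lambda _ fun n => hev.comp (measurable_id.prodMk (hpre n))

lemma drive_mem_cyl (ξ : List (Fin m) → Fin m) (u : List (Fin m)) :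
    drive ξ ∈ cyl u ↔ ∀ i (h : i < u.length), ξ (u.take i) = u[i] := by
  have key : (∀ i (h : i < u.length), drive ξ i = u[i]) ∨
      (∀ i (h : i < u.length), ξ (u.take i) = u[i]) →
      ∀ i, i ≤ u.length → pre ξ i = u.take i := by
    intro h i
    induction i with
    | zero => intro _; simp [pre]
    | succ i ih =>
      intro hi
      have ih := ih (by omega)
      rw [pre, ih, List.take_succ_eq_append_getElem (by omega)]
      congr 2
      rcases h with h | h
      · have := h i (by omega)
        rwa [drive, ih] at this
      · exact h i (by omega)
  constructor
  · intro h i hi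
    have h' : ∀ i (h : i < u.length), drive ξ i = u[i] := h
    rw [← key (Or.inl h') i hi.le]
    exact h' i hi
  · intro h i hi
    have := key (Or.inr h) i hi.le
    simp only [drive, this]
    exact h i hi

lemma exists_measure (hm : 0 < m) (W : List (Fin m) → ℝ) (hW : IsW W) :
    ∃ ν : Measure (ℕ → Fin m), IsProbabilityMeasure ν ∧ (∀ u, ν (cyl u) = ENNReal.ofReal (W u)) ∧
      MeasurePreserving (shift m) ν ν := by
  classical
  have hκ : ∀ u : List (Fin m), ∃ κ : Measure (Fin m), IsProbabilityMeasure κ ∧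
      ∀ a, κ {a} * ENNReal.ofReal (W u) = ENNReal.ofReal (W (u ++ [a])) := by
    intro u
    by_cases h0 : W u = 0
    · refine ⟨Measure.dirac ⟨0, hm⟩, inferInstance, fun a => ?_⟩
      have := hW.snoc_le a u
      rw [h0, ENNReal.ofReal_of_nonpos (by linarith : W (u ++ [a]) ≤ 0)]
      simp
    · have hpos : 0 < W u := lt_of_le_of_ne (hW.nonneg u) (Ne.symm h0)
      have hs : ∑ a, ENNReal.ofReal (W (u ++ [a]) / W u) = 1 := by
        rw [← ENNReal.ofReal_sum_of_nonneg (fun a _ => div_nonneg (hW.nonneg _) hpos.le),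
          ← Finset.sum_div, hW.snoc, div_self h0, ENNReal.ofReal_one]
      refine ⟨(PMF.ofFintype _ hs).toMeasure, inferInstance, fun a => ?_⟩
      rw [PMF.toMeasure_apply_singleton _ _ (measurableSet_singleton a), PMF.ofFintype_apply,
        ← ENNReal.ofReal_mul (div_nonneg (hW.nonneg _) hpos.le), div_mul_cancel₀ _ h0]
  choose κ hκp hκ using hκ
  let Pr : Measure (List (Fin m) → Fin m) := Measure.infinitePi κ
  let ν : Measure (ℕ → Fin m) := Pr.map drive
  have hν : IsProbabilityMeasure ν := Measure.isProbabilityMeasure_map measurable_drive.aemeasurable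
  have hprod : ∀ u, ν (cyl u) = ∏ i ∈ Finset.range u.length, κ (u.take i) {a | u[i]? = some a} := by
    intro u
    rw [Measure.map_apply measurable_drive (measurableSet_cyl u)]
    have e : drive ⁻¹' cyl u = Set.pi ((Finset.range u.length).image (fun i => u.take i) : Finset _)
        (fun v => {a : Fin m | u[v.length]? = some a}) := by
      ext ξ
      rw [Set.mem_preimage, drive_mem_cyl]
      simp only [Finset.coe_image, Set.mem_pi, Set.mem_image, Finset.coe_range, Set.mem_Iio,
        Set.mem_ofPred_eq, forall_exists_index, and_imp, forall_apply_eq_imp_iff₂]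
      refine forall_congr' fun i => forall_congr' fun hi => ?_
      rw [List.length_take, min_eq_left hi.le, List.getElem?_eq_getElem hi]
      simp [eq_comm]
    rw [e, Measure.infinitePi_pi κ (fun i _ => Set.Finite.measurableSet (Set.toFinite _)),
      Finset.prod_image]
    · refine Finset.prod_congr rfl fun i hi => ?_
      rw [List.length_take, min_eq_left (Finset.mem_range.1 hi).le]
    · intro i hi j hj hij
      have := congrArg List.length hij
      simp at this hi hj
      omega
  have hcyl : ∀ u, ν (cyl u) = ENNReal.ofReal (W u) := by
    intro u
    rw [hprod]
    induction u using List.reverseRecOn with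
    | nil => simp [hW.nil]
    | append_singleton u a ih =>
      rw [List.length_append, List.length_singleton, Finset.prod_range_succ, mul_comm, ← hκ u a, ← ih]
      congr 1
      · rw [List.take_left']
        · congr 1; ext b; simp [eq_comm]
        · rfl
      · refine Finset.prod_congr rfl fun i hi => ?_
        have := Finset.mem_range.1 hi
        rw [List.take_append_of_le_length this.le, List.getElem?_append_left this]
  refine ⟨ν, hν, hcyl, measurable_shift, ?_⟩
  have := Measure.isProbabilityMeasure_map (μ := ν) measurable_shift.aemeasurable
  refine ext_cyl _ _ fun u => ?_
  rw [Measure.map_apply measurable_shift (measurableSet_cyl u)]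
  have := sum_cons_cyl ν u
  simp_rw [hcyl, ENNReal.toReal_ofReal (hW.nonneg _), hW.cons] at this
  rw [hcyl, this, ENNReal.ofReal_toReal (measure_ne_top _ _)]

end meas
end MarkovMax


namespace MarkovMax
section final
open scoped symmDiff
variable {m : ℕ}

/-- Extend a finite word to a sequence. -/
def extw (hm : 0 < m) {k : ℕ} (w : Fin k → Fin m) : ℕ → Fin m :=
  fun n => if h : n < k then w ⟨n, h⟩ else ⟨0, hm⟩

/-- The polynomial in weights computing the integral. -/
noncomputable def GG (hm : 0 < m) (r k : ℕ) (Φ : (Fin r → (ℕ → Fin m)) → ℝ)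
    (W : List (Fin m) → ℝ) : ℝ :=
  ∑ w : Fin r → Fin k → Fin m, (∏ i, W (List.ofFn (w i))) * Φ (fun i => extw hm (w i))

lemma GG_continuous (hm : 0 < m) (r k : ℕ) (Φ : (Fin r → (ℕ → Fin m)) → ℝ) :
    Continuous (GG hm r k Φ) := by
  unfold GG
  fun_prop

lemma integral_eq (hm : 0 < m) (r k : ℕ) (Φ : (Fin r → (ℕ → Fin m)) → ℝ)
    (hdep : ∀ x y : Fin r → (ℕ → Fin m), (∀ i : Fin r, ∀ j < k, x i j = y i j) → Φ x = Φ y)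
    (μ : Measure (ℕ → Fin m)) [IsProbabilityMeasure μ] :
    ∫ y, Φ y ∂(Measure.pi fun _ : Fin r => μ) = GG hm r k Φ (Wm μ) := by
  have hΦ : ∀ y, Φ y = (fun w : Fin r → Fin k → Fin m => Φ (fun i => extw hm (w i)))
      ((fun (y : Fin r → (ℕ → Fin m)) i => pref k (y i)) y) := by
    intro y
    refine hdep _ _ fun i j hj => ?_
    simp [extw, hj, pref]
  have hmeas : Measurable (fun (y : Fin r → (ℕ → Fin m)) i => pref k (y i)) :=
    measurable_pi_lambda _ fun i => (measurable_pref k).comp (measurable_pi_apply i)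
  have := Measure.isProbabilityMeasure_map (μ := μ) (measurable_pref k).aemeasurable
  rw [integral_congr_ae (Eventually.of_forall hΦ),
    ← integral_map (μ := Measure.pi fun _ : Fin r => μ) (φ := fun y i => pref k (y i))
      (f := fun w : Fin r → Fin k → Fin m => Φ (fun i => extw hm (w i)))
      hmeas.aemeasurable (measurable_of_finite _).aestronglyMeasurable,
    Measure.pi_map_pi (μ := fun _ : Fin r => μ) (f := fun _ => pref k)
      (fun i => (measurable_pref k).aemeasurable),
    integral_fintype (Integrable.of_finite)]
  refine Finset.sum_congr rfl fun w _ => ?_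
  rw [smul_eq_mul, measureReal_def, Measure.pi_singleton, ENNReal.toReal_prod]
  congr 1
  refine Finset.prod_congr rfl fun i _ => ?_
  rw [Measure.map_apply (measurable_pref k) (measurableSet_singleton _), Wm, cyl_ofFn]

open Real in
lemma eta_bound (q p t : ℝ) (hq : 0 ≤ q) (hqp : q ≤ p) (ht : 0 < t) (ht1 : t ≤ 1) (d : ℝ)
    (hd : q ≤ d ∨ p - q ≤ d) (hd0 : 0 ≤ d) :
    negMulLog q ≤ -(q * log p) + (t * p + (1 - log t) * d) := by
  have hlt : log t ≤ 0 := log_nonpos ht.le ht1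
  rcases hq.eq_or_lt with h | h
  · rw [← h]; simp
    have : 0 ≤ (1 - log t) * d := mul_nonneg (by linarith) hd0
    have : 0 ≤ t * p := by rw [← h] at hqp; positivity
    linarith
  have hp : 0 < p := by linarith
  rw [negMulLog]
  rcases hd with hd | hd
  · have h1 := log_le_sub_one_of_pos (show 0 < t * p / q by positivity)
    rw [log_div (by positivity) h.ne', log_mul ht.ne' hp.ne'] at h1
    have h2 := mul_le_mul_of_nonneg_left h1 h.le
    have e : q * (t * p / q - 1) = t * p - q := by field_simp
    rw [e] at h2
    have h3 : (1 - log t) * q ≤ (1 - log t) * d := mul_le_mul_of_nonneg_left hd (by linarith)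
    nlinarith
  · have h1 := log_le_sub_one_of_pos (show 0 < p / q by positivity)
    rw [log_div hp.ne' h.ne'] at h1
    have h2 := mul_le_mul_of_nonneg_left h1 h.le
    have e : q * (p / q - 1) = p - q := by field_simp
    rw [e] at h2
    have h3 : 1 * d ≤ (1 - log t) * d := mul_le_mul_of_nonneg_right (by linarith) hd0
    have : 0 ≤ t * p := by positivity
    nlinarith

lemma cond_small (μ : Measure (ℕ → Fin m)) [IsProbabilityMeasure μ] {k : ℕ}
    (P : (ℕ → Fin m) → Fin k) (hP : Measurable P) (ε : ℝ) (hε : 0 < ε) :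
    ∃ L, ent μ (fun x => (P x, pref L x)) - ent μ (pref L) ≤ ε := by
  have hk : (0:ℝ) < k + 1 := by positivity
  let t : ℝ := min 1 (ε / (2 * (k + 1)))
  have ht : 0 < t := lt_min one_pos (by positivity)
  have ht1 : t ≤ 1 := min_le_left _ _
  have ht2 : t ≤ ε / (2 * (k + 1)) := min_le_right _ _
  have hlt : Real.log t ≤ 0 := Real.log_nonpos ht.le ht1
  let C : ℝ := 1 - Real.log t
  have hC : 0 < C := by simp only [C]; linarith
  let δ : ℝ := ε / (2 * (k + 1)) / C
  have hδ : 0 < δ := by positivity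
  have hdense := Measure.MeasureDense.of_generateFrom_isSetAlgebra_finite μ
    (cylAlg_isSetAlgebra (m := m)) cylAlg_gen
  have happ : ∀ i : Fin k, ∃ n, ∃ S : Set (Fin n → Fin m),
      (μ ((P ⁻¹' {i}) ∆ (pref n ⁻¹' S))).toReal ≤ δ := by
    intro i
    obtain ⟨_, ⟨n, S, rfl⟩, h⟩ := hdense.approx (P ⁻¹' {i}) (hP (measurableSet_singleton i))
      (measure_ne_top _ _) δ hδ
    exact ⟨n, S, ENNReal.toReal_le_of_le_ofReal hδ.le h.le⟩
  choose n S hS using happ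
  let L := Finset.univ.sup n
  have hlift : ∀ i, ∃ S' : Set (Fin L → Fin m),
      (pref (n i) ⁻¹' S i : Set (ℕ → Fin m)) = pref L ⁻¹' S' := fun i =>
    cyl_lift (Finset.le_sup (Finset.mem_univ i)) (S i)
  choose S' hS' using hlift
  refine ⟨L, ?_⟩
  let D : Fin k → Set (ℕ → Fin m) := fun i => (P ⁻¹' {i}) ∆ (pref L ⁻¹' S' i)
  have hD : ∀ i, (μ (D i)).toReal ≤ δ := fun i => by simp only [D]; rw [← hS']; exact hS i
  let p : (Fin L → Fin m) → ℝ := fun w => (μ (pref L ⁻¹' {w})).toReal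
  let q : Fin k → (Fin L → Fin m) → ℝ := fun i w => (μ (P ⁻¹' {i} ∩ pref L ⁻¹' {w})).toReal
  let d : Fin k → (Fin L → Fin m) → ℝ := fun i w => (μ (pref L ⁻¹' {w} ∩ D i)).toReal
  have hqp : ∀ w, ∑ i, q i w = p w := fun w => sum_fiber P hP _
  have hsd : ∀ i, ∑ w, d i w = (μ (D i)).toReal := fun i => sum_fiber (pref L) (measurable_pref L) _
  have hsp : ∑ w, p w = 1 := by
    have := sum_fiber (μ := μ) (pref L) (measurable_pref L) Set.univ
    simpa using this
  have hmono : ∀ {A B : Set (ℕ → Fin m)}, A ⊆ B → (μ A).toReal ≤ (μ B).toReal := fun h =>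
    ENNReal.toReal_mono (measure_ne_top _ _) (measure_mono h)
  have hbd : ∀ i w, Real.negMulLog (q i w) ≤ -(q i w * Real.log (p w)) + (t * p w + C * d i w) := by
    intro i w
    refine eta_bound _ _ _ ENNReal.toReal_nonneg (hmono Set.inter_subset_right) ht ht1 _ ?_
      ENNReal.toReal_nonneg
    by_cases hw : w ∈ S' i
    · right
      have : p w = q i w + (μ (pref L ⁻¹' {w} \ P ⁻¹' {i})).toReal := by
        simp only [p, q]
        rw [← ENNReal.toReal_add (measure_ne_top _ _) (measure_ne_top _ _), Set.inter_comm,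
          measure_inter_add_sdiff _ (hP (measurableSet_singleton i))]
      change p w - q i w ≤ _
      rw [this, add_sub_cancel_left]
      refine hmono fun x hx => ⟨hx.1, Or.inr ⟨?_, hx.2⟩⟩
      have : pref L x = w := hx.1
      simpa [this] using hw
    · left
      refine hmono fun x hx => ⟨hx.2, Or.inl ⟨hx.1, ?_⟩⟩
      have : pref L x = w := hx.2
      simpa [this] using hw
  have hsum : ∑ i, ∑ w, Real.negMulLog (q i w) ≤
      ∑ i, ∑ w, (-(q i w * Real.log (p w)) + (t * p w + C * d i w)) :=
    Finset.sum_le_sum fun i _ => Finset.sum_le_sum fun w _ => hbd i w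
  simp only [Finset.sum_add_distrib, ← Finset.mul_sum, hsp, hsd] at hsum
  have e1 : ∑ i, ∑ w, -(q i w * Real.log (p w)) = ∑ w, Real.negMulLog (p w) := by
    rw [Finset.sum_comm]
    refine Finset.sum_congr rfl fun w _ => ?_
    rw [Finset.sum_neg_distrib, ← Finset.sum_mul, hqp, Real.negMulLog, neg_mul]
  rw [e1] at hsum
  have e2 : ent μ (fun x => (P x, pref L x)) = ∑ i, ∑ w, Real.negMulLog (q i w) := by
    unfold ent
    rw [Fintype.sum_prod_type]
    simp only [pre_prod, q]
  have e3 : ent μ (pref L) = ∑ w, Real.negMulLog (p w) := rfl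
  rw [e2, e3]
  have h5 : ∑ i, (μ (D i)).toReal ≤ k * δ := by
    calc _ ≤ ∑ i : Fin k, δ := Finset.sum_le_sum fun i _ => hD i
      _ = k * δ := by simp
  have h6 : C * ∑ i, (μ (D i)).toReal ≤ k * (ε / (2 * (k + 1))) := by
    calc _ ≤ C * (k * δ) := mul_le_mul_of_nonneg_left h5 hC.le
      _ = k * (ε / (2 * (k + 1))) := by simp only [δ]; field_simp
  have h7 : (k:ℝ) * t ≤ k * (ε / (2 * (k + 1))) := by gcongr
  have h8 : (k:ℝ) * (ε / (2 * (k + 1))) ≤ ε / 2 := by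
    rw [← mul_div_assoc, div_le_div_iff₀ (by positivity) (by positivity)]
    nlinarith
  have h9 : t * ∑ _i : Fin k, (1 : ℝ) = k * t := by simp [mul_comm]
  rw [h9] at hsum
  linarith

lemma ent_preserving {Ω ι : Type*} [MeasurableSpace Ω] [Fintype ι] [MeasurableSpace ι]
    [MeasurableSingletonClass ι] (μ : Measure Ω) (T : Ω → Ω)
    (hT : MeasurePreserving T μ μ) (X : Ω → ι) (hX : Measurable X) :
    ent μ (fun ω => X (T ω)) = ent μ X := by
  unfold ent
  refine Finset.sum_congr rfl fun i _ => ?_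
  rw [← hT.measure_preimage (hX (measurableSet_singleton i)).nullMeasurableSet]
  rfl

lemma ent_nonneg {Ω ι : Type*} [MeasurableSpace Ω] [Fintype ι] (μ : Measure Ω)
    [IsProbabilityMeasure μ] (X : Ω → ι) : 0 ≤ ent μ X :=
  Finset.sum_nonneg fun _ _ => Real.negMulLog_nonneg ENNReal.toReal_nonneg
    (ENNReal.toReal_le_of_le_ofReal zero_le_one (by simpa using prob_le_one))

lemma ent_bound (μ : Measure (ℕ → Fin m)) [IsProbabilityMeasure μ]
    (hμ : MeasurePreserving (shift m) μ μ) {k : ℕ} (P : (ℕ → Fin m) → Fin k) (hP : Measurable P)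
    (L s n : ℕ) :
    ent μ (fun x => fun j : Fin (n + 1) => P ((shift m)^[(j : ℕ)] x)) ≤
      HW (Wm μ) (s + (n + 1 + L)) +
        (n + 1) * (ent μ (fun x => (P x, pref L x)) - ent μ (pref L)) := by
  set N := s + (n + 1 + L) with hN
  have hmj : ∀ j : Fin (n+1), Measurable (fun x : ℕ → Fin m => P ((shift m)^[(j : ℕ)] x)) :=
    fun j => hP.comp (measurable_shift.iterate _)
  have hmX : Measurable (fun x => fun j : Fin (n + 1) => P ((shift m)^[(j : ℕ)] x)) :=
    measurable_pi_lambda _ hmj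
  have h1 := ent_le_pair (μ := μ) (pref N)
    (fun x => fun j : Fin (n + 1) => P ((shift m)^[(j : ℕ)] x)) (measurable_pref N)
  have h2 := ent_inj (μ := μ)
    (fun x => (pref N x, fun j : Fin (n + 1) => P ((shift m)^[(j : ℕ)] x)))
    Prod.swap Prod.swap_injective
  simp only [Prod.swap_prod_mk] at h2
  have h3 := ent_chain (μ := μ) (n + 1) (fun j x => P ((shift m)^[(j : ℕ)] x)) (pref N) hmj
  have h4 : ∀ j : Fin (n + 1), ent μ (fun x => (P ((shift m)^[(j : ℕ)] x), pref N x))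
      - ent μ (pref N) ≤ ent μ (fun x => (P x, pref L x)) - ent μ (pref L) := by
    intro j
    let f : (Fin N → Fin m) → (Fin L → Fin m) := fun w i => w ⟨i + j, by omega⟩
    have hf : ∀ x, f (pref N x) = pref L ((shift m)^[(j : ℕ)] x) := by
      intro x; ext i; simp [f, pref, shift_iter]
    have h := ent_cond (μ := μ) (fun x => P ((shift m)^[(j : ℕ)] x)) (pref N) f (hmj j)
      (measurable_pref N)
    simp only [hf] at h
    have e1 := ent_preserving μ _ (hμ.iterate j) (fun x => (P x, pref L x))
      (hP.prodMk (measurable_pref L))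
    have e2 := ent_preserving μ _ (hμ.iterate j) (pref L) (measurable_pref L)
    rw [e1, e2] at h
    exact h
  have h5 := Finset.sum_le_sum fun j (_ : j ∈ Finset.univ) => h4 j
  rw [Finset.sum_const, Finset.card_univ, Fintype.card_fin, nsmul_eq_mul] at h5
  push_cast at h5
  rw [HW_Wm]
  linarith

lemma hKS_le (μ : Measure (ℕ → Fin m)) [IsProbabilityMeasure μ]
    (hμ : MeasurePreserving (shift m) μ μ) (s : ℕ) :
    hKS (shift m) μ ≤ ENNReal.ofReal (HW (Wm μ) (s + 1) - HW (Wm μ) s) := by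
  unfold hKS
  refine iSup_le fun k => iSup_le fun P => iSup_le fun hP => ENNReal.ofReal_le_ofReal ?_
  set F := HW (Wm μ) (s + 1) - HW (Wm μ) s with hF
  have hbdd : BddBelow (Set.range fun n : ℕ =>
      partEntropy μ (fun x => fun j : Fin (n + 1) => P ((shift m)^[(j : ℕ)] x)) / ((n : ℝ) + 1)) := by
    refine ⟨0, ?_⟩
    rintro _ ⟨n, rfl⟩
    exact div_nonneg (ent_nonneg μ _) (by positivity)
  refine le_of_forall_pos_le_add fun ε hε => ?_
  obtain ⟨L, hL⟩ := cond_small μ P hP (ε / 2) (by positivity)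
  obtain ⟨n, hn⟩ := exists_nat_gt ((HW (Wm μ) s + L * F) / (ε / 2))
  refine (ciInf_le hbdd n).trans ?_
  have hn1 : (0 : ℝ) < n + 1 := by positivity
  rw [div_le_iff₀ hn1]
  have h1 := ent_bound μ hμ P hP L s n
  have h2 := (Wm_isW μ hμ).HW_le s (n + 1 + L)
  rw [← hF] at h2
  push_cast at h2
  rw [div_lt_iff₀ (by positivity)] at hn
  have h3 := mul_le_mul_of_nonneg_left hL hn1.le
  change ent μ _ ≤ _
  nlinarith

lemma le_hKS (μ : Measure (ℕ → Fin m)) (F : ℝ) (h : ∀ n : ℕ, n * F ≤ HW (Wm μ) n) :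
    ENNReal.ofReal F ≤ hKS (shift m) μ := by
  unfold hKS
  refine le_trans ?_ (le_iSup_of_le m (le_iSup_of_le (fun x => x 0)
    (le_iSup_of_le (measurable_pi_apply 0) le_rfl)))
  refine ENNReal.ofReal_le_ofReal (le_ciInf fun n => ?_)
  rw [le_div_iff₀ (by positivity)]
  have := h (n + 1)
  rw [HW_Wm] at this
  have e : partEntropy μ (fun x => fun j : Fin (n + 1) => (shift m)^[(j : ℕ)] x 0) =
      ent μ (pref (n + 1)) := by
    change ent μ _ = _
    congr 1
    ext x j
    simp [shift_iter, pref]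
  rw [e]
  push_cast at this
  linarith

end final
end MarkovMax


/-- (Theorem 5.2) On the full shift `(Σ_m, σ)`, `m ≥ 2`, if the kernel
`Φ : Σ_m^r → ℝ` depends only on the first `k` coordinates of each of its `r` variables, then
for every `α` with `M_Φ(α) ≠ ∅` the supremum in the variational principle
`h_top(E_Φ(α)) = sup_{μ ∈ M_Φ(α)} h_μ` is attained by a `(k-1)`-step Markov measure. -/
theorem sup_hKS_attained_by_markov_measure
    (m : ℕ) (hm : 2 ≤ m) (r : ℕ) (hr : 1 ≤ r) (k : ℕ) (hk : 1 ≤ k)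
    (Φ : (Fin r → (ℕ → Fin m)) → ℝ)
    (hdep : ∀ x y : Fin r → (ℕ → Fin m),
      (∀ i : Fin r, ∀ j < k, x i j = y i j) → Φ x = Φ y)
    (α : ℝ) (hM : (Mset (shift m) Φ α).Nonempty) :
    ∃ ν : Measure (ℕ → Fin m), IsProbabilityMeasure ν ∧ IsMarkovOfStep (k - 1) ν ∧
      ν ∈ Mset (shift m) Φ α ∧
      hKS (shift m) ν = ⨆ μ ∈ Mset (shift m) Φ α, hKS (shift m) μ := by
  have hm0 : 0 < m := by omega
  have hW : ∀ μ ∈ Mset (shift m) Φ α, MarkovMax.IsW (MarkovMax.Wm μ) ∧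
      MarkovMax.GG hm0 r k Φ (MarkovMax.Wm μ) = α := by
    rintro μ ⟨h1, h2, h3⟩
    exact ⟨MarkovMax.Wm_isW μ h2, by rw [← MarkovMax.integral_eq hm0 r k Φ hdep μ, h3]⟩
  obtain ⟨μ0, hμ0⟩ := hM
  obtain ⟨W, hWW, hWG, hmax⟩ := MarkovMax.exists_max (k - 1) _
    (MarkovMax.GG_continuous hm0 r k Φ) α ⟨_, hW μ0 hμ0⟩
  have hV := MarkovMax.mk_isW hWW (k - 1)
  obtain ⟨ν, hν, hcyl, hinv⟩ := MarkovMax.exists_measure hm0 _ hV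
  have hWν : MarkovMax.Wm ν = MarkovMax.mk (k - 1) W := by
    ext u
    rw [MarkovMax.Wm, hcyl, ENNReal.toReal_ofReal (hV.nonneg u)]
  have hmem : ν ∈ Mset (shift m) Φ α := by
    refine ⟨hν, hinv, ?_⟩
    rw [MarkovMax.integral_eq hm0 r k Φ hdep ν, hWν, ← hWG]
    unfold MarkovMax.GG
    refine Finset.sum_congr rfl fun w _ => ?_
    congr 1
    refine Finset.prod_congr rfl fun i _ => MarkovMax.mk_short hWW _ _ ?_
    simp
    omega
  refine ⟨ν, hν, ⟨hinv, fun u a hu => ?_⟩, hmem, le_antisymm (le_iSup₂_of_le ν hmem le_rfl) ?_⟩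
  · rw [hcyl, hcyl, hcyl, hcyl, ← ENNReal.ofReal_mul (hV.nonneg _),
      ← ENNReal.ofReal_mul (hV.nonneg _), MarkovMax.mk_markov hWW (k - 1) u a hu]
  · refine iSup₂_le fun μ hμ => ?_
    have hp : IsProbabilityMeasure μ := hμ.1
    refine (MarkovMax.hKS_le μ hμ.2.1 (k - 1)).trans ?_
    refine (ENNReal.ofReal_le_ofReal (hmax _ (hW μ hμ).1 (hW μ hμ).2)).trans ?_
    refine MarkovMax.le_hKS ν _ fun n => ?_
    rw [hWν]
    exact MarkovMax.HW_mk_ge hWW (k - 1) n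

end Shift
end
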